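/- arXiv:2005.12432 — 4 statements merged into one kernel-verified Lean document; each statement's English description precedes it below -/
import Mathlib

section
/- Let N be a positive integer, let A be the N×N real matrix (indices 1,…,N) with entries A_{ij} = 1/2 if |i−j| = 1 and 0 otherwise, let B be the N×N real matrix with entries B_{ij} = 1/2 if |i−j| = 2 and 0 otherwise, and let I be the N×N identity matrix. Then for every real x ≠ 0, det(4x²(I+A) − (I−B)) = (1/(2^{N+2} x)) · U_{N+1}(x) · U'_{N+1}(x), where U' denotes the derivative of U. -/
open Polynomial Chebyshev

/-- Evaluation of the Chebyshev polynomial of the second kind. -/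
noncomputable def Ucheb (n : ℤ) (x : ℝ) : ℝ := (Polynomial.Chebyshev.U ℝ n).eval x

/-- Evaluation of the derivative of the Chebyshev polynomial of the second kind. -/
noncomputable def Ucheb' (n : ℤ) (x : ℝ) : ℝ :=
  (Polynomial.derivative (Polynomial.Chebyshev.U ℝ n)).eval x

/-- The N×N matrix with entries 1/2 on the first off-diagonals and 0 elsewhere. -/
noncomputable def matA (N : ℕ) : Matrix (Fin N) (Fin N) ℝ :=
  fun i j => if ((i : ℤ) - (j : ℤ)).natAbs = 1 then 1/2 else 0

/-- The N×N matrix with entries 1/2 on the second off-diagonals and 0 elsewhere. -/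
noncomputable def matB (N : ℕ) : Matrix (Fin N) (Fin N) ℝ :=
  fun i j => if ((i : ℤ) - (j : ℤ)).natAbs = 2 then 1/2 else 0

/-- The determinant of a Toeplitz matrix with two superdiagonals, in terms of the coefficients `h`
of the reciprocal of its symbol. -/
theorem det_toeplitz_eq_of_convolution {R : Type*} [CommRing R] (b h : ℤ → R)
    (hb : ∀ k < -2, b k = 0) (hh : ∀ k < 0, h k = 0)
    (hconv : ∀ m : ℕ, ∑ q ∈ Finset.range (m + 1), b (m - q - 2) * h q = if m = 0 then 1 else 0)
    (N : ℕ) :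
    (Matrix.of fun i j : Fin N => b ((i : ℤ) - j)).det
      = b (-2) ^ (N + 2) * (h N ^ 2 - h (N - 1) * h (N + 1)) := by
  have hconv₀ (M p : ℕ) (hp : p < M) :
      ∑ q ∈ Finset.range M, b (p - q - 2) * h q = if p = 0 then 1 else 0 := by
    rw [← hconv p]
    refine (Finset.sum_subset (Finset.range_subset_range.2 hp) fun q _ hq => ?_).symm
    rw [hb _ (by simp at hq; omega), zero_mul]
  have hconv₁ (M p : ℕ) (hp : p < M) :
      ∑ q ∈ Finset.range M, b (p - q - 2) * h (q - 1) = if p = 1 then 1 else 0 := by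
    obtain ⟨M, rfl⟩ : ∃ M', M = M' + 1 := ⟨M - 1, by omega⟩
    rw [Finset.sum_range_succ', hh (((0 : ℕ) : ℤ) - 1) (by simp), mul_zero, add_zero]
    rcases p with _ | p
    · rw [if_neg (by simp)]
      exact Finset.sum_eq_zero fun q _ => by rw [hb _ (by push_cast; omega), zero_mul]
    · rw [← (show (if p = 0 then (1 : R) else 0) = if p + 1 = 1 then 1 else 0 by simp),
        ← hconv₀ M p (by omega)]
      refine Finset.sum_congr rfl fun q _ => ?_
      push_cast
      ring_nf
  let ρ : Equiv.Perm (Fin (N + 2)) := Equiv.addRight 1 * Equiv.addRight 1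
  have hρ (p : Fin (N + 2)) : (ρ p : ℕ) = if (p : ℕ) < N then (p : ℕ) + 2 else (p : ℕ) - N := by
    have : ρ p = p + 2 := by
      simp only [ρ, Equiv.Perm.mul_apply, Equiv.coe_addRight, add_assoc]
      rfl
    rw [this, Fin.val_add]
    have h2 : ((2 : Fin (N + 2)) : ℕ) = 2 % (N + 2) := rfl
    rw [h2, Nat.add_mod_mod]
    split_ifs with hp
    · exact Nat.mod_eq_of_lt (by omega)
    · rw [show (p : ℕ) + 2 = (p - N) + (N + 2) by omega, Nat.add_mod_right]
      exact Nat.mod_eq_of_lt (by omega)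
  let L : Matrix (Fin (N + 2)) (Fin (N + 2)) R := .of fun p q => b ((p : ℤ) - q - 2)
  let K : Matrix (Fin (N + 2)) (Fin (N + 2)) R := .of fun q j =>
    if (j : ℕ) < N then if q = j then 1 else 0 else h ((q : ℤ) - ((j : ℤ) - N))
  let S : Matrix (Fin (N + 2)) (Fin (N + 2)) R := .of fun p j =>
    if (j : ℕ) < N then L (ρ p) j else if p = j then 1 else 0
  have hmul : L.submatrix ρ id * K = S := by
    ext p j
    simp only [Matrix.mul_apply, Matrix.submatrix_apply, id, K, S, Matrix.of_apply]
    split_ifs with hj hpj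
    · simp
    all_goals
      have hval := hρ p
      simp only [L, Matrix.of_apply]
      rw [Fin.sum_univ_eq_sum_range
        (fun q => b (((ρ p : ℕ) : ℤ) - q - 2) * h ((q : ℤ) - ((j : ℤ) - N))) (N + 2)]
      have hpj' : p = j ↔ (p : ℕ) = j := Fin.ext_iff
      obtain hj' | hj' : (j : ℕ) = N ∨ (j : ℕ) = N + 1 := by omega
      · have e : ((j : ℕ) : ℤ) - N = 0 := by omega
        simp only [e, sub_zero]
        rw [hconv₀ _ _ (ρ p).2]
        split_ifs at hval ⊢ <;> first | rfl | omega
      · have e : ((j : ℕ) : ℤ) - N = 1 := by omega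
        simp only [e]
        rw [hconv₁ _ _ (ρ p).2]
        split_ifs at hval ⊢ <;> first | rfl | omega
  have hdetL : (L.submatrix ρ id).det = b (-2) ^ (N + 2) := by
    rw [Matrix.det_permute, map_mul, Int.units_mul_self, Matrix.det_of_isLowerTriangular]
    · simp [L]
    · intro p q hpq
      exact hb _ (by have : (p : ℕ) < q := hpq; omega)
  have hdetK : K.det = h N ^ 2 - h (N - 1) * h (N + 1) := by
    rw [← Matrix.det_submatrix_equiv_self finSumFinEquiv, ← Matrix.fromBlocks_toBlocks
      (K.submatrix _ _)]
    have h₁₁ : (K.submatrix finSumFinEquiv finSumFinEquiv).toBlocks₁₁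
        = (1 : Matrix (Fin N) (Fin N) R) := by
      ext i j
      simp [Matrix.toBlocks₁₁, K, Matrix.one_apply, Fin.ext_iff]
    have h₂₁ : (K.submatrix finSumFinEquiv finSumFinEquiv).toBlocks₂₁
        = (0 : Matrix (Fin 2) (Fin N) R) := by
      ext i j
      simp [Matrix.toBlocks₂₁, K, Fin.ext_iff]
      omega
    rw [h₁₁, h₂₁, Matrix.det_fromBlocks_zero₂₁, Matrix.det_one, one_mul, Matrix.det_fin_two]
    simp [Matrix.toBlocks₂₂, K]
    ring_nf
  have hdetS : S.det = (Matrix.of fun i j : Fin N => b ((i : ℤ) - j)).det := by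
    rw [← Matrix.det_submatrix_equiv_self finSumFinEquiv, ← Matrix.fromBlocks_toBlocks
      (S.submatrix _ _)]
    have h₁₁ : (S.submatrix finSumFinEquiv finSumFinEquiv).toBlocks₁₁
        = Matrix.of fun i j : Fin N => b ((i : ℤ) - j) := by
      ext i j
      simp [Matrix.toBlocks₁₁, S, L, hρ]
      ring_nf
    have h₁₂ : (S.submatrix finSumFinEquiv finSumFinEquiv).toBlocks₁₂
        = (0 : Matrix (Fin N) (Fin 2) R) := by
      ext i j
      simp [Matrix.toBlocks₁₂, S, Fin.ext_iff]
      omega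
    have h₂₂ : (S.submatrix finSumFinEquiv finSumFinEquiv).toBlocks₂₂
        = (1 : Matrix (Fin 2) (Fin 2) R) := by
      ext i j
      simp [Matrix.toBlocks₂₂, S, Matrix.one_apply, Fin.ext_iff]
    rw [h₁₁, h₁₂, h₂₂, Matrix.det_fromBlocks_zero₁₂, Matrix.det_one, mul_one]
  rw [← hdetS, ← hmul, Matrix.det_mul, hdetL, hdetK]

section ChebyshevSums

variable (R : Type*) [CommRing R]

theorem U_sq_add_U_sq (n : ℕ) :
    U R n ^ 2 + U R (n + 1) ^ 2 - 2 * X * U R n * U R (n + 1) = 1 := by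
  induction n with
  | zero =>
    simp
    ring
  | succ n ih =>
    push_cast
    rw [add_assoc (n : ℤ) 1 1, one_add_one_eq_two, U_add_two]
    linear_combination ih

theorem four_mul_one_sub_X_sq_mul_sum_U_mul_U (n : ℕ) :
    4 * (1 - X ^ 2) * ∑ j ∈ Finset.range n, U R j * U R (j + 1)
      = 2 * ((n : R[X]) + 1) * X - U R n * (U R (n + 1) - U R (n - 1)) := by
  induction n with
  | zero =>
    simp
  | succ n ih =>
    have h₁ := U_sq_add_U_sq R n
    have h₂ := U_add_two R n
    have h₃ := U_sub_one R n
    rw [Finset.sum_range_succ, mul_add, ih]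
    push_cast
    rw [add_sub_cancel_right, add_assoc (n : ℤ) 1 1, one_add_one_eq_two, h₂, h₃]
    linear_combination 2 * X * h₁

theorem sum_U_mul_U_mul_U_sub_U [IsDomain R] [NeZero (2 : R)] (n : ℕ) :
    (∑ j ∈ Finset.range n, U R j * U R (j + 1)) * (U R (n - 1) - U R (n + 1))
      + U R (n - 1) * U R n * U R (n + 1) = X * derivative (U R n) := by
  have h4 : (4 : R[X]) * (1 - X ^ 2) ≠ 0 := by
    have h2 : (2 : R[X]) ≠ 0 := fun h =>
      two_ne_zero (α := R) (by simpa using congrArg (eval 0) h)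
    have hX : (1 - X ^ 2 : R[X]) ≠ 0 := by
      intro h
      have := congrArg (fun p => coeff p 2) h
      simp [coeff_one] at this
    rw [show (4 : R[X]) = 2 * 2 by norm_num]
    exact mul_ne_zero (mul_ne_zero h2 h2) hX
  refine mul_left_cancel₀ h4 ?_
  have hS := four_mul_one_sub_X_sq_mul_sum_U_mul_U R n
  have hD := add_one_mul_T_eq_poly_in_U (R := R) n
  have hT := two_mul_T_eq_U_sub_U R (n - 1)
  have h₁ := U_sq_add_U_sq R n
  have h₃ := U_sub_one R n
  rw [show (n : ℤ) - 1 + 2 = n + 1 by ring] at hT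
  push_cast at hD
  have hU : U R n * ((U R (n + 1) - U R (n - 1)) ^ 2 +
      4 * (1 - X ^ 2) * (U R (n - 1) * U R (n + 1)) - 4 * X ^ 2) = 0 := by
    rw [h₃]
    linear_combination 4 * X ^ 2 * U R n * h₁
  linear_combination (U R (n - 1) - U R (n + 1)) * hS + hU - 4 * X * hD
    + 2 * X * (n + 1) * hT

theorem sum_U_mul_U_recurrence (n : ℕ) :
    let s : ℕ → R[X] := fun n => ∑ j ∈ Finset.range n, U R j * U R (j + 1)
    s (n + 4) - 4 * X ^ 2 * s (n + 3) + 2 * (4 * X ^ 2 - 1) * s (n + 2) - 4 * X ^ 2 * s (n + 1)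
      + s n = 0 := by
  intro s
  simp only [s, Finset.sum_range_succ]
  push_cast
  have h₂ := U_add_two R n
  simp only [add_assoc, Int.reduceAdd]
  have h₃ := U_add_two R (n + 1)
  have h₄ := U_add_two R (n + 2)
  simp only [add_assoc, Int.reduceAdd] at h₃ h₄
  rw [h₄, h₃, h₂]
  ring

end ChebyshevSums

theorem stmt0 (N : ℕ) (hN : 0 < N) (x : ℝ) (hx : x ≠ 0) :
    ((4 * x ^ 2) • ((1 : Matrix (Fin N) (Fin N) ℝ) + matA N)
        - ((1 : Matrix (Fin N) (Fin N) ℝ) - matB N)).det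
      = (1 / (2 ^ (N + 2) * x)) * Ucheb (N + 1) x * Ucheb' (N + 1) x := by
  let s : ℕ → ℝ[X] := fun n => ∑ j ∈ Finset.range n, U ℝ j * U ℝ (j + 1)
  have hs (n : ℕ) : s (n + 1) = s n + U ℝ n * U ℝ (n + 1) := Finset.sum_range_succ _ _
  have hs₀ : s 0 = 0 := rfl
  let b : ℤ → ℝ := fun k => if k.natAbs = 0 then 4 * x ^ 2 - 1 else
    if k.natAbs = 1 then 2 * x ^ 2 else if k.natAbs = 2 then 1 / 2 else 0
  let h : ℤ → ℝ := fun k =>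
    if k < 0 then 0 else (-1) ^ k.toNat * (s (k.toNat + 1)).eval x / x
  have hb (k : ℤ) (hk : k < -2) : b k = 0 := by
    simp only [b]
    rw [if_neg (by omega), if_neg (by omega), if_neg (by omega)]
  have hh (k : ℤ) (hk : k < 0) : h k = 0 := if_pos hk
  have hnat (n : ℕ) : h n = (-1) ^ n * (s (n + 1)).eval x / x := by simp [h]
  have b₀ : b 0 = 4 * x ^ 2 - 1 := by simp [b]
  have b₁ : b 1 = 2 * x ^ 2 := by simp [b]
  have b₂ : b 2 = 1 / 2 := by simp [b]
  have b₃ : b (-1) = 2 * x ^ 2 := by simp [b]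
  have b₄ : b (-2) = 1 / 2 := by simp [b]
  have hrec (n : ℕ) : (s (n + 4)).eval x - 4 * x ^ 2 * (s (n + 3)).eval x
      + 2 * (4 * x ^ 2 - 1) * (s (n + 2)).eval x - 4 * x ^ 2 * (s (n + 1)).eval x
      + (s n).eval x = 0 := by
    simpa [s] using congrArg (eval x) (sum_U_mul_U_recurrence ℝ n)
  have s₁ : (s 1).eval x = 2 * x := by simp [s]
  have s₂ : (s 2).eval x = 8 * x ^ 3 := by
    rw [hs, eval_add, s₁]
    simp [one_add_one_eq_two, U_two]
    ring
  have s₃ : (s 3).eval x = 4 * x ^ 2 * (s 2).eval x - 2 * (4 * x ^ 2 - 1) * (s 1).eval x := by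
    have := U_add_two ℝ 1
    norm_num at this
    rw [hs, eval_add, s₁, s₂]
    simp [this, U_two]
    ring
  have s₄ := hrec 0
  simp only [hs₀, eval_zero, zero_add] at s₄
  have hconv (m : ℕ) :
      ∑ q ∈ Finset.range (m + 1), b (m - q - 2) * h q = if m = 0 then 1 else 0 := by
    obtain rfl | rfl | rfl | rfl | ⟨k, rfl⟩ :
        m = 0 ∨ m = 1 ∨ m = 2 ∨ m = 3 ∨ ∃ k, m = k + 4 := by
      by_cases hm : 4 ≤ m
      · exact .inr (.inr (.inr (.inr ⟨m - 4, by omega⟩)))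
      · omega
    · simp only [Finset.sum_range_succ, Finset.sum_range_zero, hnat]
      norm_num [b₀, b₁, b₂, b₃, b₄, s₁]
      field_simp
    · simp only [Finset.sum_range_succ, Finset.sum_range_zero, hnat]
      norm_num [b₀, b₁, b₂, b₃, b₄, s₁, s₂]
      field_simp
      ring
    · simp only [Finset.sum_range_succ, Finset.sum_range_zero, hnat]
      norm_num [b₀, b₁, b₂, b₃, b₄, s₃]
      field_simp
      ring
    · simp only [Finset.sum_range_succ, Finset.sum_range_zero, hnat]
      norm_num [b₀, b₁, b₂, b₃, b₄]
      field_simp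
      linear_combination -s₄
    · simp only [Finset.sum_range_succ _ (k + _), Finset.sum_range_succ _ k]
      rw [Finset.sum_eq_zero]
      · simp only [hnat]
        push_cast
        ring_nf
        norm_num [b₀, b₁, b₂, b₃, b₄]
        have := hrec (k + 1)
        ring_nf at this
        field_simp
        linear_combination (-1) ^ k * this
      · intro q hq
        have hq' : q < k := Finset.mem_range.1 hq
        have : b (((k + 4 : ℕ) : ℤ) - q - 2) = 0 := by
          simp only [b]
          rw [if_neg (by omega), if_neg (by omega), if_neg (by omega)]
        rw [this, zero_mul]
  have hM : (4 * x ^ 2) • ((1 : Matrix (Fin N) (Fin N) ℝ) + matA N)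
        - ((1 : Matrix (Fin N) (Fin N) ℝ) - matB N)
      = Matrix.of fun i j : Fin N => b ((i : ℤ) - j) := by
    ext i j
    have hij : i = j ↔ ((i : ℤ) - j).natAbs = 0 := by rw [Fin.ext_iff]; omega
    simp only [Matrix.sub_apply, Matrix.smul_apply, Matrix.add_apply, Matrix.one_apply, matA, matB,
      Matrix.of_apply, b, smul_eq_mul, hij]
    split_ifs <;> first | omega | ring
  obtain ⟨n, rfl⟩ : ∃ n, N = n + 1 := ⟨N - 1, by omega⟩
  have key := congrArg (eval x) (sum_U_mul_U_mul_U_sub_U ℝ (n + 2))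
  change eval x (s (n + 2) * _ + _) = _ at key
  rw [hM, det_toeplitz_eq_of_convolution b h hb hh hconv, b₄]
  have e₁ : (((n + 1 : ℕ) : ℤ) - 1) = (n : ℕ) := by push_cast; ring
  have e₂ : (((n + 1 : ℕ) : ℤ) + 1) = (n + 2 : ℕ) := by push_cast; ring
  have e₃ : (((n + 2 : ℕ) : ℤ) - 1) = (n + 1 : ℕ) := by push_cast; ring
  have h₃ := congrArg (eval x) (hs (n + 2))
  have h₂ := congrArg (eval x) (show s (n + 2) = _ from hs (n + 1))
  rw [e₂] at h₂
  rw [e₃] at key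
  simp only [eval_add, eval_sub, eval_mul, eval_X] at key h₂ h₃
  rw [e₁, e₂, hnat, hnat, hnat, Ucheb, Ucheb', h₃]
  have hsq : ((-1 : ℝ) ^ n) ^ 2 = 1 := by rw [← pow_mul, mul_comm, pow_mul]; simp
  simp only [pow_succ (-1 : ℝ), one_div, inv_pow]
  field_simp
  simp only [hsq]
  linear_combination eval x (U ℝ (n + 2 : ℕ)) * key + (eval x (s (n + 2))
    + eval x (U ℝ (n + 2 : ℕ)) * eval x (U ℝ ((n + 2 : ℕ) + 1))) * h₂
end

section
/- Let N be an odd positive integer. Consider the set S_N of coefficient vectors (α_1,…,α_N) ∈ ℝ^N with α_1 = 1 such that ∑_{j=1}^N α_j sin(jt) ≥ 0 for all t ∈ [0, π]. Then the quantity ∑_{j=1}^N α_j attains a maximum over S_N, and this maximum equals (1/4)·csc²(π/(2(N+2))) = 1/(4 sin²(π/(2(N+2)))). -/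
open Real

/-- The set `S_N` of coefficient vectors `(α_1, …, α_N) ∈ ℝ^N` (indexed here by `Fin N`,
with `α i` standing for `α_{i+1}`) such that `α_1 = 1` and the sine polynomial
`∑_{j=1}^N α_j sin (j t)` is nonnegative on `[0, π]`. -/
def sineSet (N : ℕ) : Set (Fin N → ℝ) :=
  {α | (∀ i : Fin N, (i : ℕ) = 0 → α i = 1) ∧
    ∀ t ∈ Set.Icc (0 : ℝ) Real.pi, 0 ≤ ∑ j : Fin N, α j * Real.sin (((j : ℕ) + 1) * t)}

namespace SinePolynomial

/-- The odd multiples of `π / M`, for `k < M` the nodes of a quadrature formula on `[0, 2π]`. -/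
noncomputable def node (M k : ℕ) : ℝ := (2 * k + 1) * (π / M)

lemma sum_cos_node {M j : ℕ} (hj : 0 < j) (hjM : j < M) :
    ∑ k ∈ Finset.range M, cos (j * node M k) = 0 := by
  have hM : (0 : ℝ) < M := by exact_mod_cast hj.trans hjM
  have hj' : (0 : ℝ) < j := by exact_mod_cast hj
  have hjM' : (j : ℝ) < M := by exact_mod_cast hjM
  have hs : 0 < sin (j * (π / M)) := by
    apply sin_pos_of_pos_of_lt_pi
    · have := pi_pos
      positivity
    · rw [← mul_div_assoc, div_lt_iff₀ hM]
      nlinarith [pi_pos]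
  have key : ∀ n : ℕ, 2 * sin (j * (π / M)) * ∑ k ∈ Finset.range n, cos (j * node M k)
      = sin (2 * n * (j * (π / M))) := by
    intro n
    induction n with
    | zero => simp
    | succ n ih =>
      rw [Finset.sum_range_succ, mul_add, ih]
      have h1 : sin (2 * n * (j * (π / M))) = sin (j * node M n - j * (π / M)) := by
        congr 1; unfold node; ring
      have h2 : sin (2 * (n + 1 : ℕ) * (j * (π / M))) = sin (j * node M n + j * (π / M)) := by
        congr 1; unfold node; push_cast; ring
      rw [h1, h2, sin_sub, sin_add]
      ring
  have h := key M
  have h0 : 2 * (M : ℝ) * (j * (π / M)) = (2 * j : ℕ) * π := by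
    push_cast
    field_simp
  rw [h0, sin_nat_mul_pi] at h
  exact (mul_eq_zero.mp h).resolve_left (by positivity)

lemma sum_sin_mul_sin_node {M j : ℕ} (hjM : j + 2 < M) :
    ∑ k ∈ Finset.range M, sin ((j + 1) * node M k) * sin (node M k)
      = if j = 0 then (M : ℝ) / 2 else 0 := by
  have h : ∀ k, sin ((j + 1) * node M k) * sin (node M k)
      = (cos (j * node M k) - cos ((j + 2 : ℕ) * node M k)) / 2 := by
    intro k
    have h1 : (j : ℝ) * node M k = (j + 1) * node M k - node M k := by ring
    have h2 : ((j + 2 : ℕ) : ℝ) * node M k = (j + 1) * node M k + node M k := by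
      push_cast; ring
    rw [h1, h2, cos_sub, cos_add]
    ring
  simp_rw [h]
  rw [← Finset.sum_div, Finset.sum_sub_distrib, sum_cos_node (by omega) hjM]
  split_ifs with hj
  · simp [hj]
  · rw [sum_cos_node (by omega) (by omega)]
    simp

lemma sin_half_node_pos {M k : ℕ} (hk : k < M) : 0 < sin (node M k / 2) := by
  have hM : (0 : ℝ) < M := by exact_mod_cast (Nat.zero_le k).trans_lt hk
  have hk' : (k : ℝ) + 1 ≤ M := by exact_mod_cast hk
  have := pi_pos
  apply sin_pos_of_pos_of_lt_pi
  · unfold node; positivity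
  · unfold node
    rw [← mul_div_assoc, div_div, div_lt_iff₀ (by positivity)]
    nlinarith

lemma sum_sin_mul_cot_node {M j : ℕ} (hjM : j + 1 < M) :
    ∑ k ∈ Finset.range M, sin ((j + 1) * node M k) * (cos (node M k / 2) / sin (node M k / 2))
      = M := by
  have hstep : ∀ i : ℕ, ∀ k ∈ Finset.range M,
      sin ((i + 1) * node M k) * (cos (node M k / 2) / sin (node M k / 2))
        = sin (i * node M k) * (cos (node M k / 2) / sin (node M k / 2))
          + (cos ((i + 1 : ℕ) * node M k) + cos (i * node M k)) := by
    intro i k hk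
    have hs := (sin_half_node_pos (Finset.mem_range.mp hk)).ne'
    have h1 : ((i : ℝ) + 1) * node M k = i * node M k + 2 * (node M k / 2) := by ring
    push_cast
    rw [h1, sin_add, cos_add, sin_two_mul, cos_two_mul]
    have := sin_sq_add_cos_sq (node M k / 2)
    field_simp
    linear_combination 2 * sin (i * node M k) * cos (node M k / 2) * this
  induction j with
  | zero =>
    rw [Finset.sum_congr rfl (hstep 0), Finset.sum_add_distrib, Finset.sum_add_distrib,
      sum_cos_node (by omega) hjM]
    simp
  | succ j ih =>
    rw [Finset.sum_congr rfl (hstep (j + 1)), Finset.sum_add_distrib, Finset.sum_add_distrib,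
      sum_cos_node (by omega) hjM, sum_cos_node (by omega) (by omega)]
    simpa using ih (by omega)

/-- The weight of the quadrature formula with parameter `l`. -/
noncomputable def weight (l t : ℝ) : ℝ := 2 * l * sin t - cos (t / 2) / sin (t / 2)

/-- The sine polynomial with coefficients `a`. -/
noncomputable def sinePoly {N : ℕ} (a : Fin N → ℝ) (t : ℝ) : ℝ :=
  ∑ j : Fin N, a j * sin (((j : ℕ) + 1) * t)

lemma sum_sinePoly_mul {N M : ℕ} (a : Fin N → ℝ) (f : ℝ → ℝ) :
    ∑ k ∈ Finset.range M, sinePoly a (node M k) * f (node M k)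
      = ∑ j : Fin N, a j *
        ∑ k ∈ Finset.range M, sin (((j : ℕ) + 1) * node M k) * f (node M k) := by
  simp_rw [sinePoly, Finset.sum_mul, Finset.mul_sum]
  rw [Finset.sum_comm]
  simp_rw [mul_assoc]

lemma sum_sinePoly_mul_sin {n : ℕ} (a : Fin (n + 1) → ℝ) :
    ∑ k ∈ Finset.range (n + 3), sinePoly a (node (n + 3) k) * sin (node (n + 3) k)
      = (n + 3 : ℕ) / 2 * a 0 := by
  rw [sum_sinePoly_mul, Fin.sum_univ_succ, Fin.val_zero,
    sum_sin_mul_sin_node (by omega : 0 + 2 < n + 3), if_pos rfl, Finset.sum_eq_zero, add_zero,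
    mul_comm]
  intro j _
  rw [sum_sin_mul_sin_node (by simp), if_neg (by simp), mul_zero]

lemma sum_sinePoly_mul_weight {n : ℕ} (a : Fin (n + 1) → ℝ) (l : ℝ) :
    ∑ k ∈ Finset.range (n + 3), sinePoly a (node (n + 3) k) * weight l (node (n + 3) k)
      = (n + 3 : ℕ) * (l * a 0 - ∑ j, a j) := by
  have h : ∀ k, sinePoly a (node (n + 3) k) * weight l (node (n + 3) k)
      = 2 * l * (sinePoly a (node (n + 3) k) * sin (node (n + 3) k))
        - sinePoly a (node (n + 3) k) *
          (cos (node (n + 3) k / 2) / sin (node (n + 3) k / 2)) := by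
    intro k; simp only [weight]; ring
  rw [Finset.sum_congr rfl fun k _ => h k, Finset.sum_sub_distrib, ← Finset.mul_sum,
    sum_sinePoly_mul_sin, sum_sinePoly_mul a fun t => cos (t / 2) / sin (t / 2)]
  have h2 : ∀ j : Fin (n + 1), a j * ∑ k ∈ Finset.range (n + 3),
      sin (((j : ℕ) + 1) * node (n + 3) k) *
        (cos (node (n + 3) k / 2) / sin (node (n + 3) k / 2)) = a j * (n + 3 : ℕ) := by
    intro j
    rw [sum_sin_mul_cot_node (by omega)]
  rw [Finset.sum_congr rfl fun j _ => h2 j, ← Finset.sum_mul]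
  ring

lemma sinePoly_two_pi_sub {N : ℕ} (a : Fin N → ℝ) (t : ℝ) :
    sinePoly a (2 * π - t) = -sinePoly a t := by
  unfold sinePoly
  rw [← Finset.sum_neg_distrib]
  refine Finset.sum_congr rfl fun j _ => ?_
  have h : (((j : ℕ) : ℝ) + 1) * (2 * π - t)
      = ((j + 1 : ℕ) : ℝ) * (2 * π) - ((j : ℕ) + 1) * t := by push_cast; ring
  rw [h, sin_nat_mul_two_pi_sub]
  ring

lemma weight_two_pi_sub (l t : ℝ) : weight l (2 * π - t) = -weight l t := by
  have h : (2 * π - t) / 2 = π - t / 2 := by ring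
  rw [weight, weight, h, sin_pi_sub, cos_pi_sub, sin_two_pi_sub]
  ring

lemma node_reflect {M k : ℕ} (hk : k < M) : node M (M - 1 - k) = 2 * π - node M k := by
  have hM : (M : ℝ) ≠ 0 := by
    have : M ≠ 0 := by omega
    exact_mod_cast this
  unfold node
  rw [Nat.sub_sub, Nat.cast_sub (by omega)]
  push_cast
  field_simp
  ring

/-- A statement about the nodes that is invariant under `t ↦ 2π - t` only has to be checked
on the first half of them. -/
lemma forall_node {M : ℕ} {p : ℝ → Prop} (hp : ∀ t, p (2 * π - t) → p t)
    (h : ∀ k, 2 * k + 1 ≤ M → p (node M k)) : ∀ k < M, p (node M k) := by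
  intro k hk
  by_cases hk2 : 2 * k + 1 ≤ M
  · exact h k hk2
  · apply hp
    rw [← node_reflect hk]
    exact h _ (by omega)

lemma node_mem_Icc {M k : ℕ} (hk : 2 * k + 1 ≤ M) : node M k ∈ Set.Icc (π / M) π := by
  have hM : (0 : ℝ) < M := by exact_mod_cast (Nat.succ_pos _).trans_le hk
  have hk' : 2 * (k : ℝ) + 1 ≤ M := by exact_mod_cast hk
  have h0 : 0 < π / M := div_pos pi_pos hM
  unfold node
  constructor
  · nlinarith [mul_nonneg k.cast_nonneg h0.le]
  · calc (2 * (k : ℝ) + 1) * (π / M) ≤ M * (π / M) := by gcongr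
      _ = π := by field_simp

/-- The extremal value. -/
noncomputable def maxValue (M : ℕ) : ℝ := 1 / 4 * (1 / sin (π / (2 * M)) ^ 2)

lemma weight_eq {t : ℝ} (l : ℝ) (ht : sin (t / 2) ≠ 0) :
    weight l t = cos (t / 2) / sin (t / 2) * (4 * l * sin (t / 2) ^ 2 - 1) := by
  have h : sin t = 2 * sin (t / 2) * cos (t / 2) := by
    rw [← sin_two_mul]; congr 1; ring
  rw [weight, h]
  field_simp
  ring

lemma sin_pi_div_pos {M : ℕ} (hM : 0 < M) : 0 < sin (π / (2 * M)) := by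
  have hM' : (1 : ℝ) ≤ M := by exact_mod_cast hM
  apply sin_pos_of_pos_of_lt_pi
  · have := pi_pos
    positivity
  · rw [div_lt_iff₀ (by positivity)]
    nlinarith [pi_pos]

lemma weight_nonneg {M : ℕ} (hM : 0 < M) {t : ℝ} (ht : t ∈ Set.Icc (π / M) π) :
    0 ≤ weight (maxValue M) t := by
  have hM' : (0 : ℝ) < M := by exact_mod_cast hM
  have h0 : 0 < π / M := div_pos pi_pos hM'
  have hs0 := sin_pi_div_pos hM
  have he : π / (2 * M) = π / M / 2 := by field_simp
  have hle : sin (π / (2 * M)) ≤ sin (t / 2) := by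
    apply sin_le_sin_of_le_of_le_pi_div_two <;> rw [he] at * <;> linarith [ht.1, ht.2, pi_pos]
  have hs : 0 < sin (t / 2) := hs0.trans_le hle
  have hc : 0 ≤ cos (t / 2) :=
    cos_nonneg_of_neg_pi_div_two_le_of_le (by linarith [ht.1, pi_pos]) (by linarith [ht.2])
  rw [weight_eq _ hs.ne']
  refine mul_nonneg (div_nonneg hc hs.le) ?_
  have : 4 * maxValue M * sin (t / 2) ^ 2 = sin (t / 2) ^ 2 / sin (π / (2 * M)) ^ 2 := by
    unfold maxValue; ring
  rw [this, sub_nonneg, one_le_div (by positivity)]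
  gcongr

lemma weight_node_zero {M : ℕ} (hM : 0 < M) : weight (maxValue M) (node M 0) = 0 := by
  have hs := sin_pi_div_pos hM
  have he : node M 0 / 2 = π / (2 * M) := by simp [node]; ring
  rw [weight_eq _ (by rw [he]; exact hs.ne'), he, maxValue]
  field_simp
  simp

lemma weight_pi (l : ℝ) : weight l π = 0 := by simp [weight]

lemma sum_le_maxValue {n : ℕ} (a : Fin (n + 1) → ℝ) (h1 : a 0 = 1)
    (ha : ∀ t ∈ Set.Icc 0 π, 0 ≤ sinePoly a t) : ∑ j, a j ≤ maxValue (n + 3) := by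
  have h0 : 0 ≤ ∑ k ∈ Finset.range (n + 3),
      sinePoly a (node (n + 3) k) * weight (maxValue (n + 3)) (node (n + 3) k) := by
    refine Finset.sum_nonneg fun k hk => ?_
    refine forall_node (p := fun t => 0 ≤ sinePoly a t * weight (maxValue (n + 3)) t)
      (fun t ht => ?_) (fun k hk => ?_) k (Finset.mem_range.mp hk)
    · rwa [sinePoly_two_pi_sub, weight_two_pi_sub, neg_mul_neg] at ht
    · have hmem := node_mem_Icc hk
      exact mul_nonneg (ha _ ⟨(div_nonneg pi_pos.le (Nat.cast_nonneg _)).trans hmem.1, hmem.2⟩)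
        (weight_nonneg (by omega) hmem)
  rw [sum_sinePoly_mul_weight, h1, mul_one] at h0
  have := nonneg_of_mul_nonneg_right h0 (by positivity : (0 : ℝ) < ((n + 3 : ℕ) : ℝ))
  linarith

lemma exists_sinePoly_eq_mul_cos_sub {N : ℕ} (a : Fin N → ℝ) (c : ℝ) :
    ∃ b : Fin (N + 1) → ℝ, ∀ t, sinePoly b t = sinePoly a t * (cos t - c) := by
  let V := Submodule.span ℝ
    (Set.range fun (j : Fin (N + 1)) (t : ℝ) => sin (((j : ℕ) + 1) * t))
  have hV : ∀ j < N + 1, (fun t : ℝ => sin (((j : ℕ) + 1) * t)) ∈ V :=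
    fun j hj => Submodule.subset_span ⟨⟨j, hj⟩, rfl⟩
  have hV' : ∀ j < N + 1, (fun t : ℝ => sin ((j : ℕ) * t)) ∈ V := by
    intro j hj
    cases j with
    | zero =>
      convert V.zero_mem using 1
      funext t
      simp
    | succ j => simpa using hV j (by omega)
  have hmem : (fun t => sinePoly a t * (cos t - c)) ∈ V := by
    have h : (fun t => sinePoly a t * (cos t - c)) = ∑ j : Fin N, a j •
        (((1 / 2 : ℝ) • ((fun t : ℝ => sin (((j + 1 : ℕ) + 1) * t))
          + fun t : ℝ => sin ((j : ℕ) * t))) - c • fun t : ℝ => sin (((j : ℕ) + 1) * t)) := by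
      funext t
      simp only [sinePoly, Finset.sum_mul, Finset.sum_apply, Pi.smul_apply, Pi.sub_apply,
        Pi.add_apply, smul_eq_mul]
      refine Finset.sum_congr rfl fun j _ => ?_
      have h1 : (((j + 1 : ℕ) : ℝ) + 1) * t = ((j : ℕ) + 1) * t + t := by push_cast; ring
      have h2 : ((j : ℕ) : ℝ) * t = ((j : ℕ) + 1) * t - t := by ring
      rw [h1, h2, sin_add, sin_sub]
      ring
    rw [h]
    refine V.sum_mem fun j _ => V.smul_mem _ (V.sub_mem (V.smul_mem _ (V.add_mem ?_ ?_))
      (V.smul_mem _ ?_))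
    · exact hV _ (by omega)
    · exact hV' _ (by omega)
    · exact hV _ (by omega)
  obtain ⟨b, hb⟩ := (Submodule.mem_span_range_iff_exists_fun ℝ).mp hmem
  refine ⟨b, fun t => ?_⟩
  rw [← congrFun hb t]
  simp [sinePoly]

lemma exists_sinePoly_eq_prod (c : ℕ → ℝ) (m : ℕ) :
    ∃ a : Fin (2 * m + 1) → ℝ, ∀ t,
      sinePoly a t = sin t * ∏ k ∈ Finset.range m, (cos t - c k) ^ 2 := by
  induction m with
  | zero => exact ⟨fun _ => 1, fun t => by simp [sinePoly]⟩
  | succ m ih =>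
    obtain ⟨a, ha⟩ := ih
    obtain ⟨b, hb⟩ := exists_sinePoly_eq_mul_cos_sub a (c m)
    obtain ⟨d, hd⟩ := exists_sinePoly_eq_mul_cos_sub b (c m)
    refine ⟨d, fun t => ?_⟩
    rw [hd, hb, ha, Finset.prod_range_succ]
    ring

lemma exists_extremal (m : ℕ) : ∃ a : Fin (2 * m + 1) → ℝ,
    a 0 = 1 ∧ (∀ t ∈ Set.Icc 0 π, 0 ≤ sinePoly a t) ∧ ∑ j, a j = maxValue (2 * m + 3) := by
  obtain ⟨a, ha⟩ := exists_sinePoly_eq_prod (fun k => cos (node (2 * m + 3) (k + 1))) m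
  have hM : (0 : ℝ) < ((2 * m + 3 : ℕ) : ℝ) := by positivity
  have hnonneg : ∀ t ∈ Set.Icc 0 π, 0 ≤ sinePoly a t := fun t ht => by
    rw [ha]
    exact mul_nonneg (sin_nonneg_of_nonneg_of_le_pi ht.1 ht.2)
      (Finset.prod_nonneg fun k _ => sq_nonneg _)
  have hpos : 0 < a 0 := by
    have hsum : 0 < ∑ k ∈ Finset.range (2 * m + 3),
        sinePoly a (node (2 * m + 3) k) * sin (node (2 * m + 3) k) := by
      refine Finset.sum_pos' (fun k _ => ?_) ⟨0, by simp, ?_⟩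
      · rw [ha, mul_right_comm]
        exact mul_nonneg (mul_self_nonneg _) (Finset.prod_nonneg fun k _ => sq_nonneg _)
      · have hmem := node_mem_Icc (M := 2 * m + 3) (k := 0) (by omega)
        have h0 : 0 < node (2 * m + 3) 0 := (div_pos pi_pos hM).trans_le hmem.1
        have hlt : ∀ k, 0 < k → node (2 * m + 3) 0 < node (2 * m + 3) k := fun k hk => by
          unfold node
          have : (0 : ℝ) < k := by exact_mod_cast hk
          have := div_pos pi_pos hM
          gcongr
        have hpi : node (2 * m + 3) 0 < π :=
          (hlt 1 one_pos).trans_le (node_mem_Icc (by omega)).2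
        have hs := sin_pos_of_pos_of_lt_pi h0 hpi
        rw [ha]
        refine mul_pos (mul_pos hs (Finset.prod_pos fun k hk => ?_)) hs
        rw [Finset.mem_range] at hk
        have := cos_lt_cos_of_nonneg_of_le_pi h0.le (node_mem_Icc (by omega)).2
          (hlt (k + 1) k.succ_pos)
        have := sub_pos.mpr this
        positivity
    rw [sum_sinePoly_mul_sin (n := 2 * m)] at hsum
    exact pos_of_mul_pos_right hsum (by positivity)
  have hzero : ∑ k ∈ Finset.range (2 * m + 3),
      sinePoly a (node (2 * m + 3) k)
        * weight (maxValue (2 * m + 3)) (node (2 * m + 3) k) = 0 := by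
    refine Finset.sum_eq_zero fun k hk => ?_
    refine forall_node (p := fun t => sinePoly a t * weight (maxValue (2 * m + 3)) t = 0)
      (fun t ht => ?_) (fun k hk => ?_) k (Finset.mem_range.mp hk)
    · rwa [sinePoly_two_pi_sub, weight_two_pi_sub, neg_mul_neg] at ht
    · rcases Nat.eq_zero_or_pos k with rfl | hk0
      · rw [weight_node_zero (by omega), mul_zero]
      · rcases (show k ≤ m + 1 by omega).eq_or_lt with rfl | hkm
        · have : node (2 * m + 3) (m + 1) = π := by
            unfold node
            push_cast
            field_simp
            ring
          rw [this, weight_pi, mul_zero]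
        · rw [ha, Finset.prod_eq_zero (i := k - 1) (by simp; omega), mul_zero, zero_mul]
          rw [Nat.sub_add_cancel hk0]
          simp
  rw [sum_sinePoly_mul_weight (n := 2 * m)] at hzero
  have hsum : ∑ j, a j = maxValue (2 * m + 3) * a 0 := by
    have := (mul_eq_zero.mp hzero).resolve_left hM.ne'
    linarith
  refine ⟨fun j => a j / a 0, div_self hpos.ne', fun t ht => ?_, ?_⟩
  · have : sinePoly (fun j => a j / a 0) t = sinePoly a t / a 0 := by
      simp_rw [sinePoly, Finset.sum_div, div_mul_eq_mul_div]
    rw [this]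
    exact div_nonneg (hnonneg t ht) hpos.le
  · rw [← Finset.sum_div, hsum, mul_div_cancel_right₀ _ hpos.ne']

end SinePolynomial

open SinePolynomial

theorem stmt13 (N : ℕ) (hN : 0 < N) (hNodd : Odd N) :
    IsGreatest ((fun α : Fin N → ℝ => ∑ j : Fin N, α j) '' sineSet N)
      ((1 / 4) * (1 / Real.sin (Real.pi / (2 * (N + 2))) ^ 2)) := by
  obtain ⟨m, rfl⟩ := hNodd
  have hval : (1 / 4) * (1 / Real.sin (Real.pi / (2 * (((2 * m + 1 : ℕ) : ℝ) + 2))) ^ 2)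
      = maxValue (2 * m + 3) := by
    unfold maxValue
    congr 5
    push_cast
    ring
  rw [hval]
  constructor
  · obtain ⟨a, h1, hnonneg, hsum⟩ := exists_extremal m
    refine ⟨a, ⟨fun i hi => ?_, hnonneg⟩, hsum⟩
    rw [← h1]
    congr 1
    exact Fin.ext hi
  · rintro _ ⟨a, ⟨h1, hnonneg⟩, rfl⟩
    exact sum_le_maxValue (n := 2 * m) a (h1 0 rfl) hnonneg
end

section
/- Let N be an even positive integer and let ν be the least positive root of U'_{N+1}(x), the derivative of the Chebyshev polynomial of the second kind of degree N+1. Consider the set S_N of coefficient vectors (α_1,…,α_N) ∈ ℝ^N with α_1 = 1 such that ∑_{j=1}^N α_j sin(jt) ≥ 0 for all t ∈ [0, π]. Then the quantity ∑_{j=1}^N α_j attains a maximum over S_N, and this maximum equals 1/(4ν²). Equivalently, the maximum equals (1/4)·csc²(ϑ), where ϑ is the least positive root of (N+3)cos((N+1)ϑ) + (N+1)cos((N+3)ϑ) = 0. -/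
open Real

namespace ChebyshevSine

open Polynomial
open Polynomial.Chebyshev hiding C

/-- Integration against the normalized weight `(2 / π) √(1 - x²)` on `[-1, 1]`, for which the
Chebyshev polynomials of the second kind are orthonormal. -/
noncomputable def moment : ℝ[X] →ₗ[ℝ] ℝ where
  toFun f := 2 / π * ∫ t in (0 : ℝ)..π, f.eval (cos t) * sin t ^ 2
  map_add' f g := by
    rw [← mul_add, ← intervalIntegral.integral_add]
    · simp only [eval_add, add_mul]
    · exact Continuous.intervalIntegrable (by fun_prop) _ _
    · exact Continuous.intervalIntegrable (by fun_prop) _ _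
  map_smul' c f := by
    simp only [eval_smul, smul_eq_mul, mul_assoc, intervalIntegral.integral_const_mul,
      RingHom.id_apply]
    ring

theorem moment_apply (f : ℝ[X]) :
    moment f = 2 / π * ∫ t in (0 : ℝ)..π, f.eval (cos t) * sin t ^ 2 := rfl

theorem moment_C_mul (c : ℝ) (f : ℝ[X]) : moment (C c * f) = c * moment f := by
  rw [← smul_eq_C_mul, map_smul, smul_eq_mul]

theorem moment_nonneg {f : ℝ[X]} (hf : ∀ x ∈ Set.Icc (-1 : ℝ) 1, 0 ≤ f.eval x) :
    0 ≤ moment f := by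
  rw [moment_apply]
  have := pi_pos
  refine mul_nonneg (by positivity) (intervalIntegral.integral_nonneg pi_pos.le fun t _ => ?_)
  exact mul_nonneg (hf _ ⟨neg_one_le_cos t, cos_le_one t⟩) (sq_nonneg _)

theorem moment_pos {f : ℝ[X]} (hf : ∀ x ∈ Set.Icc (-1 : ℝ) 1, 0 ≤ f.eval x)
    (h0 : 0 < f.eval 0) : 0 < moment f := by
  rw [moment_apply]
  have := pi_pos
  refine mul_pos (by positivity) (intervalIntegral.integral_pos pi_pos ?_ (fun t _ => ?_) ?_)
  · exact Continuous.continuousOn (by fun_prop)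
  · exact mul_nonneg (hf _ ⟨neg_one_le_cos t, cos_le_one t⟩) (sq_nonneg _)
  · exact ⟨π / 2, ⟨by positivity, by linarith⟩, by simpa using h0⟩

theorem integral_cos_int_mul {k : ℤ} (hk : k ≠ 0) : ∫ t in (0 : ℝ)..π, cos (k * t) = 0 := by
  rw [intervalIntegral.integral_comp_mul_left (fun t => cos t) (Int.cast_ne_zero.2 hk)]
  simp [sin_int_mul_pi]

theorem moment_U_zero : moment (U ℝ 0) = 1 := by
  rw [moment_apply]
  simp only [U_zero, eval_one, one_mul, integral_sin_sq]
  simp [pi_ne_zero]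

theorem moment_U_of_pos {k : ℤ} (hk : 0 < k) : moment (U ℝ k) = 0 := by
  have h : ∀ t : ℝ, (U ℝ k).eval (cos t) * sin t ^ 2
      = 1 / 2 * (cos ((k : ℤ) * t) - cos ((k + 2 : ℤ) * t)) := by
    intro t
    rw [pow_two, ← mul_assoc, U_real_cos,
      show ((k : ℤ) : ℝ) * t = (k + 1) * t - t by ring,
      show ((k + 2 : ℤ) : ℝ) * t = (k + 1) * t + t by push_cast; ring, cos_sub, cos_add]
    ring
  simp only [moment_apply, h]
  rw [intervalIntegral.integral_const_mul, intervalIntegral.integral_sub,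
    integral_cos_int_mul (by omega), integral_cos_int_mul (by omega)]
  · simp
  · exact Continuous.intervalIntegrable (by fun_prop) _ _
  · exact Continuous.intervalIntegrable (by fun_prop) _ _

theorem two_mul_X_mul_U (k : ℤ) : 2 * X * U ℝ k = U ℝ (k + 1) + U ℝ (k - 1) := by
  rw [U_add_one]; ring

theorem moment_X_pow_mul_U (i : ℕ) {k : ℤ} (hik : (i : ℤ) < k) :
    moment (X ^ i * U ℝ k) = 0 := by
  induction i generalizing k with
  | zero => simpa using moment_U_of_pos (by simpa using hik)
  | succ i ih =>
    have h : X ^ (i + 1) * U ℝ k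
        = C (1 / 2 : ℝ) * (X ^ i * U ℝ (k + 1)) + C (1 / 2 : ℝ) * (X ^ i * U ℝ (k - 1)) := by
      have h2 : (C (1 / 2 : ℝ) : ℝ[X]) * 2 = 1 := by
        rw [← C_ofNat, ← map_mul]; norm_num
      linear_combination (C (1 / 2 : ℝ) * X ^ i) * two_mul_X_mul_U k
        - (X ^ (i + 1) * U ℝ k) * h2
    push_cast at hik
    rw [h, map_add, moment_C_mul, moment_C_mul, ih (by omega), ih (by omega)]
    simp

theorem moment_mul_U {g : ℝ[X]} {k : ℤ} (hg : (g.natDegree : ℤ) < k) :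
    moment (g * U ℝ k) = 0 := by
  rw [g.as_sum_range_C_mul_X_pow, Finset.sum_mul, map_sum]
  refine Finset.sum_eq_zero fun i hi => ?_
  rw [mul_assoc, moment_C_mul, moment_X_pow_mul_U, mul_zero]
  have := Finset.mem_range.1 hi
  omega

/-- `(1 - x²) U'_k` in the basis of Chebyshev polynomials of the second kind. -/
theorem two_mul_one_sub_X_sq_mul_derivative_U (k : ℤ) :
    2 * ((1 - X ^ 2) * derivative (U ℝ k))
      = ((k : ℝ[X]) + 2) * U ℝ (k - 1) - (k : ℝ[X]) * U ℝ (k + 1) := by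
  have h1 := add_one_mul_T_eq_poly_in_U (R := ℝ) k
  have h2 := T_eq_U_sub_X_mul_U ℝ (k + 1)
  rw [add_sub_cancel_right] at h2
  have h3 := two_mul_X_mul_U k
  linear_combination 2 * h1 - 2 * (k + 1 : ℝ[X]) * h2 + (k + 2 : ℝ[X]) * h3

theorem moment_one_sub_X_sq_mul_derivative_U_mul {g : ℝ[X]} {k : ℤ}
    (hg : (g.natDegree : ℤ) < k - 1) :
    moment ((1 - X ^ 2) * derivative (U ℝ k) * g) = 0 := by
  have h : C (2 : ℝ) * ((1 - X ^ 2) * derivative (U ℝ k) * g)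
      = C ((k : ℝ) + 2) * (g * U ℝ (k - 1)) - C (k : ℝ) * (g * U ℝ (k + 1)) := by
    have := two_mul_one_sub_X_sq_mul_derivative_U k
    simp only [C_ofNat, C_add, map_intCast]
    linear_combination g * this
  have h' := congrArg moment h
  rw [map_sub, moment_C_mul, moment_C_mul, moment_C_mul, moment_mul_U hg,
    moment_mul_U (by omega)] at h'
  linarith

/-- A Gauss-type quadrature formula: interpolatory quadrature at the nodes `s` is exact beyond
the interpolation degree when the nodal polynomial is orthogonal to low degrees. -/
theorem quadrature (L : ℝ[X] →ₗ[ℝ] ℝ) (s : Finset ℝ) (d : ℕ)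
    (horth : ∀ g : ℝ[X], g.natDegree < d → L (Lagrange.nodal s id * g) = 0)
    {f : ℝ[X]} (hf : f.natDegree < s.card + d) :
    L f = ∑ x ∈ s, f.eval x * L (Lagrange.basis s id x) := by
  have hinj : Set.InjOn (id : ℝ → ℝ) s := Function.injective_id.injOn
  have hm := Lagrange.nodal_monic (s := s) (v := (id : ℝ → ℝ))
  have hd := modByMonic_add_div f (Lagrange.nodal s (id : ℝ → ℝ))
  have hmod : f %ₘ Lagrange.nodal s id = Lagrange.interpolate s id (fun x => f.eval x) := by
    refine Lagrange.eq_interpolate_of_eval_eq _ hinj ?_ fun x hx => ?_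
    · simpa using degree_modByMonic_lt f hm
    · have := congrArg (eval x) hd
      have h0 : eval x (Lagrange.nodal s (id : ℝ → ℝ)) = 0 :=
        Lagrange.eval_nodal_at_node (v := (id : ℝ → ℝ)) hx
      simpa [h0] using this
  rcases Nat.eq_zero_or_pos d with rfl | hdpos
  · have hz : f /ₘ Lagrange.nodal s id = 0 := by
      rw [divByMonic_eq_zero_iff hm, Lagrange.degree_nodal]
      exact degree_le_natDegree.trans_lt (by exact_mod_cast hf)
    rw [hz, mul_zero, add_zero, hmod] at hd
    conv_lhs => rw [← hd]
    simp [Lagrange.interpolate_apply, map_sum, ← smul_eq_C_mul]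
  · have hq := horth (f /ₘ Lagrange.nodal s id) (by
      rw [natDegree_divByMonic f hm, Lagrange.natDegree_nodal]; omega)
    conv_lhs => rw [← hd, map_add, hq, hmod]
    simp [Lagrange.interpolate_apply, map_sum, ← smul_eq_C_mul]

/-- Composition of `U_k` with `2x² - 1`, in terms of odd Chebyshev polynomials. -/
theorem U_two_mul_add_one (k : ℕ) :
    U ℝ (2 * k + 1) = 2 * X * (U ℝ k).comp (2 * X ^ 2 - 1) := by
  induction k using Nat.twoStepInduction with
  | zero => simp
  | one =>
    have a := U_add_two ℝ 1
    norm_num at a ⊢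
    rw [a, U_two]
    ring
  | more k h0 h1 =>
    have e (j : ℤ) : U ℝ (j + 4) = 2 * (2 * X ^ 2 - 1) * U ℝ (j + 2) - U ℝ j := by
      have a := U_add_two ℝ (j + 2)
      have b := U_add_two ℝ (j + 1)
      have c := U_add_two ℝ j
      ring_nf at a b c ⊢
      linear_combination a + 2 * X * b + c
    have h2 : (U ℝ ((k + 1 + 1 : ℕ) : ℤ)).comp (2 * X ^ 2 - 1)
        = 2 * (2 * X ^ 2 - 1) * (U ℝ ((k + 1 : ℕ) : ℤ)).comp (2 * X ^ 2 - 1)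
          - (U ℝ k).comp (2 * X ^ 2 - 1) := by
      push_cast
      rw [show (k : ℤ) + 1 + 1 = k + 2 by ring, U_add_two]
      simp
    have h3 := e (2 * k + 1)
    rw [show (2 * k + 1 + 2 : ℤ) = 2 * ((k + 1 : ℕ) : ℤ) + 1 by push_cast; ring, h0, h1,
      show (2 * k + 1 + 4 : ℤ) = 2 * ((k + 1 + 1 : ℕ) : ℤ) + 1 by push_cast; ring] at h3
    rw [h3, h2]
    ring

theorem U_comp_succ_add (k : ℕ) :
    (U ℝ ((k + 1 : ℕ) : ℤ)).comp (2 * X ^ 2 - 1) + (U ℝ k).comp (2 * X ^ 2 - 1)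
      = U ℝ (2 * k + 2) := by
  have h1 := U_two_mul_add_one k
  have h2 := U_two_mul_add_one (k + 1)
  have h3 := two_mul_X_mul_U (2 * k + 2)
  rw [show (2 * k + 2 + 1 : ℤ) = 2 * ((k + 1 : ℕ) : ℤ) + 1 by push_cast; ring,
    show (2 * k + 2 - 1 : ℤ) = 2 * k + 1 by ring, h1, h2, ← mul_add] at h3
  exact (mul_left_cancel₀ (mul_ne_zero two_ne_zero X_ne_zero) h3).symm

theorem moment_U_comp (k : ℕ) : moment ((U ℝ k).comp (2 * X ^ 2 - 1)) = (-1) ^ k := by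
  induction k with
  | zero => simpa using moment_U_zero
  | succ k ih =>
    have h := congrArg moment (U_comp_succ_add k)
    rw [map_add, ih, moment_U_of_pos (by positivity)] at h
    linarith [pow_succ (-1 : ℝ) k]

theorem moment_X_sq_mul_U_comp (k : ℕ) :
    moment (X ^ 2 * (U ℝ k).comp (2 * X ^ 2 - 1)) = if k = 0 then 1 / 4 else 0 := by
  have h : C (4 : ℝ) * (X ^ 2 * (U ℝ k).comp (2 * X ^ 2 - 1))
      = U ℝ (2 * k + 2) + U ℝ (2 * k) := by
    have h1 := U_two_mul_add_one k
    have h2 := two_mul_X_mul_U (2 * k + 1)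
    rw [show (2 * k + 1 + 1 : ℤ) = 2 * k + 2 by ring, add_sub_cancel_right, h1] at h2
    rw [← h2, C_ofNat]
    ring
  have h' := congrArg moment h
  rw [moment_C_mul, map_add, moment_U_of_pos (by positivity)] at h'
  split_ifs with hk
  · subst hk
    have := moment_U_zero
    simp only [Nat.cast_zero, mul_zero] at h' ⊢
    linarith
  · rw [moment_U_of_pos (by positivity)] at h'
    linarith

theorem exists_eq_sum_U (d : ℕ) {f : ℝ[X]} (hf : f.degree < d) :
    ∃ c : ℕ → ℝ, f = ∑ j ∈ Finset.range d, C (c j) * U ℝ j := by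
  induction d generalizing f with
  | zero => exact ⟨0, by simpa using hf⟩
  | succ d ih =>
    have hU : (U ℝ d).coeff d ≠ 0 := by
      have := leadingCoeff_U_natCast ℝ d
      rw [leadingCoeff, natDegree_U_natCast] at this
      rw [this]; positivity
    obtain ⟨c, hc⟩ := ih (f := f - C (f.coeff d / (U ℝ d).coeff d) * U ℝ d) (by
      rw [degree_lt_iff_coeff_zero] at hf ⊢
      intro i hi
      rcases hi.eq_or_lt with rfl | hi
      · simp [hU]
      · have h0 : (U ℝ d).coeff i = 0 :=
          coeff_eq_zero_of_natDegree_lt (by rw [natDegree_U_natCast]; exact hi)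
        simp [hf i hi, h0])
    refine ⟨Function.update c d (f.coeff d / (U ℝ d).coeff d), ?_⟩
    rw [Finset.sum_range_succ, Function.update_self, ← sub_eq_iff_eq_add, hc]
    refine Finset.sum_congr rfl fun j hj => ?_
    rw [Function.update_of_ne (Finset.mem_range.1 hj).ne]


theorem card_roots_U (n : ℕ) : (U ℝ n).roots.toFinset.card = n := by
  rw [roots_U_real, Finset.val_toFinset, Finset.card_image_of_injOn, Finset.card_range]
  exact (Finset.range n).nodup_map_iff_injOn.mp (roots_U_real_nodup n)

theorem splits_U (n : ℕ) : (U ℝ n).Splits := by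
  rw [splits_iff_card_roots, natDegree_U_natCast]
  refine le_antisymm ((card_roots' _).trans_eq (natDegree_U_natCast ℝ n)) ?_
  conv_lhs => rw [← card_roots_U n]
  exact Multiset.toFinset_card_le _

theorem lt_one_of_mem_roots_U {n : ℕ} {z : ℝ} (hz : z ∈ (U ℝ n).roots) : z < 1 := by
  refine lt_of_le_of_ne ?_ fun h => ?_
  · rw [roots_U_real, Finset.mem_val, Finset.mem_image] at hz
    obtain ⟨k, -, rfl⟩ := hz
    exact cos_le_one _
  · have h1 := U_eval_one (R := ℝ) n
    rw [← h, (mem_roots'.1 hz).2.eq_zero] at h1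
    have : (0 : ℝ) < n + 1 := by positivity
    push_cast at h1
    linarith

theorem derivative_U_eval_ne_zero_of_one_le {n : ℕ} (hn : 0 < n) {x : ℝ} (hx : 1 ≤ x) :
    (derivative (U ℝ n)).eval x ≠ 0 := by
  have hU0 : U ℝ n ≠ 0 := U_ne_zero ℝ n (by omega)
  have hUx : (U ℝ n).eval x ≠ 0 := fun h =>
    (lt_one_of_mem_roots_U ((mem_roots hU0).2 h)).not_ge hx
  rw [(splits_U n).eval_derivative_eq_eval_mul_sum hUx]
  refine mul_ne_zero hUx (ne_of_gt ?_)
  obtain ⟨s, hs⟩ : ∃ s : Finset ℝ, (U ℝ n).roots = s.val := ⟨_, roots_U_real n⟩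
  have hcard := card_roots_U n
  rw [hs, Finset.val_toFinset] at hcard
  rw [hs]
  refine Finset.sum_pos (s := s) (f := fun z => 1 / (x - z)) (fun z hz => ?_)
    (Finset.card_pos.1 (by omega))
  have hz' : z ∈ (U ℝ n).roots := by rw [hs]; exact hz
  exact one_div_pos.2 (by linarith [lt_one_of_mem_roots_U hz'])

/-- The polynomial `P` with `U'_{2k+1}(x) = P(2x² - 1)`. -/
noncomputable def halfDerivative (k : ℕ) : ℝ[X] :=
  2 * U ℝ k + 4 * ((X + 1) * derivative (U ℝ k))

theorem derivative_U_two_mul_add_one (k : ℕ) :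
    derivative (U ℝ (2 * k + 1)) = (halfDerivative k).comp (2 * X ^ 2 - 1) := by
  rw [U_two_mul_add_one, halfDerivative]
  simp [derivative_comp]
  ring

theorem natDegree_halfDerivative_le (k : ℕ) : (halfDerivative k).natDegree ≤ k := by
  have h0 : (U ℝ k).natDegree = k := natDegree_U_natCast ℝ k
  have h1 : (derivative (U ℝ k)).natDegree ≤ k - 1 := by
    rw [natDegree_derivative, h0]
  rw [halfDerivative]
  rcases Nat.eq_zero_or_pos k with rfl | hk
  · simp
  refine natDegree_add_le_of_degree_le ?_ ?_
  · compute_degree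
  · compute_degree
    omega

theorem halfDerivative_eval_neg_one_ne_zero (k : ℕ) : (halfDerivative k).eval (-1) ≠ 0 := by
  have h : ((k : ℤ).negOnePow : ℝ) * (k + 1) ≠ 0 :=
    mul_ne_zero (by simp) (by positivity)
  simpa [halfDerivative, U_eval_neg_one] using h

theorem derivative_U_eval_neg (k : ℕ) (x : ℝ) :
    (derivative (U ℝ (2 * k + 1))).eval (-x) = (derivative (U ℝ (2 * k + 1))).eval x := by
  simp [derivative_U_two_mul_add_one]

theorem derivative_U_eval_zero_ne_zero (k : ℕ) :
    (derivative (U ℝ (2 * k + 1))).eval 0 ≠ 0 := by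
  simpa [derivative_U_two_mul_add_one] using halfDerivative_eval_neg_one_ne_zero k

theorem abs_lt_one_of_derivative_U_eval_eq_zero {k : ℕ} {x : ℝ}
    (hx : (derivative (U ℝ (2 * k + 1))).eval x = 0) : |x| < 1 := by
  by_contra! h
  refine derivative_U_eval_ne_zero_of_one_le (n := 2 * k + 1) (by omega) h ?_
  push_cast
  rcases abs_choice x with h' | h' <;> rw [h']
  · exact hx
  · rwa [derivative_U_eval_neg]

theorem natDegree_derivative_U (n : ℕ) : (derivative (U ℝ n)).natDegree = n - 1 := by
  have := natDegree_U_natCast ℝ n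
  rw [natDegree_derivative, this]

/-- The distinct roots of `U'_n`. -/
noncomputable def critNodes (n : ℕ) : Finset ℝ := (derivative (U ℝ n)).roots.toFinset

theorem card_critNodes {n : ℕ} (hn : 0 < n) : (critNodes n).card = n - 1 := by
  refine le_antisymm ?_ ?_
  · exact ((Multiset.toFinset_card_le _).trans (card_roots' _)).trans_eq
      (natDegree_derivative_U n)
  · have := card_roots_toFinset_le_derivative (U ℝ n)
    rw [card_roots_U] at this
    rw [critNodes]
    omega

theorem derivative_U_eq_C_mul_nodal {n : ℕ} (hn : 0 < n) :
    derivative (U ℝ n)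
      = C (derivative (U ℝ n)).leadingCoeff * Lagrange.nodal (critNodes n) id := by
  have hcard := card_critNodes hn
  have hdeg := natDegree_derivative_U n
  have hle := card_roots' (derivative (U ℝ n))
  have hle' := Multiset.toFinset_card_le (derivative (U ℝ n)).roots
  rw [critNodes] at hcard
  have hnodup : (derivative (U ℝ n)).roots.Nodup := by
    rw [← Multiset.toFinset_card_eq_card_iff_nodup]; omega
  have h := C_leadingCoeff_mul_prod_multiset_X_sub_C (p := derivative (U ℝ n)) (by omega)
  rw [Lagrange.nodal_eq, critNodes, Finset.prod_eq_multiset_prod, Multiset.toFinset_val,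
    hnodup.dedup]
  exact h.symm

theorem mem_critNodes {n : ℕ} (hn : 1 < n) {x : ℝ} :
    x ∈ critNodes n ↔ (derivative (U ℝ n)).eval x = 0 := by
  have h0 : derivative (U ℝ n) ≠ 0 := by
    intro h
    have := natDegree_derivative_U n
    rw [h, natDegree_zero] at this
    omega
  rw [critNodes, Multiset.mem_toFinset, mem_roots h0, IsRoot.def]

/-- The Gauss–Lobatto rule for `moment` has nonnegative weights. -/
theorem moment_nonneg_of_nonneg_at_nodes {k : ℕ} (hk : 0 < k) {f : ℝ[X]}
    (hf : f.natDegree < 2 * (2 * k + 1)) (h1 : 0 ≤ f.eval 1) (hneg : 0 ≤ f.eval (-1))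
    (hc : ∀ x, (derivative (U ℝ (2 * k + 1))).eval x = 0 → 0 ≤ f.eval x) :
    0 ≤ moment f := by
  set R := critNodes (2 * k + 1)
  have hcard : R.card = 2 * k := card_critNodes (by omega)
  have hmem : ∀ {x}, x ∈ R ↔ (derivative (U ℝ (2 * k + 1))).eval x = 0 := by
    intro x
    have := mem_critNodes (n := 2 * k + 1) (by omega) (x := x)
    push_cast at this
    exact this
  have hlt : ∀ {x}, x ∈ R → |x| < 1 := fun hx =>
    abs_lt_one_of_derivative_U_eval_eq_zero (hmem.1 hx)
  have hR1 : (1 : ℝ) ∉ R := fun h => by simpa using hlt h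
  have hRn : (-1 : ℝ) ∉ R := fun h => by simpa using hlt h
  have h1n : (1 : ℝ) ∉ insert (-1 : ℝ) R := by
    rw [Finset.mem_insert]
    rintro (h | h)
    · norm_num at h
    · exact hR1 h
  set s : Finset ℝ := insert 1 (insert (-1) R) with hs
  have hscard : s.card = 2 * k + 2 := by
    rw [hs, Finset.card_insert_of_notMem h1n, Finset.card_insert_of_notMem hRn, hcard]
  have hnodal : Lagrange.nodal s (id : ℝ → ℝ) = (X - C 1) * ((X - C (-1)) * Lagrange.nodal R id) := by
    rw [hs, Lagrange.nodal_insert_eq_nodal h1n, Lagrange.nodal_insert_eq_nodal hRn, id, id]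
  have hD := derivative_U_eq_C_mul_nodal (n := 2 * k + 1) (by omega)
  set c := (derivative (U ℝ ((2 * k + 1 : ℕ) : ℤ))).leadingCoeff
  have hc0 : c ≠ 0 := by
    intro h
    have h0 := natDegree_derivative_U (2 * k + 1)
    rw [leadingCoeff_eq_zero.1 h, natDegree_zero] at h0
    omega
  have horth : ∀ g : ℝ[X], g.natDegree < 2 * k →
      moment (Lagrange.nodal s (id : ℝ → ℝ) * g) = 0 := by
    intro g hg
    have h := moment_one_sub_X_sq_mul_derivative_U_mul (g := g) (k := ((2 * k + 1 : ℕ) : ℤ))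
      (by push_cast; omega)
    rw [hD, show (1 - X ^ 2) * (C c * Lagrange.nodal R id) * g
      = C (-c) * (Lagrange.nodal s (id : ℝ → ℝ) * g) by
        rw [hnodal]; simp only [map_neg, map_one]; ring, moment_C_mul] at h
    exact (mul_eq_zero.1 h).resolve_left (neg_ne_zero.2 hc0)
  have hweight : ∀ x ∈ s, ∀ p : ℝ[X], p.natDegree < 2 * (2 * k + 1) → 0 < p.eval x →
      (∀ y ∈ s, y ≠ x → p.eval y = 0) → (∀ y ∈ Set.Icc (-1 : ℝ) 1, 0 ≤ p.eval y) →
      0 ≤ moment (Lagrange.basis s id x) := by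
    intro x hx p hp hpx hpy hp0
    have h := quadrature moment s (2 * k) horth (f := p) (by omega)
    rw [Finset.sum_eq_single_of_mem x hx fun y hy hyx => by rw [hpy y hy hyx, zero_mul]] at h
    have := moment_nonneg hp0
    rw [h] at this
    exact nonneg_of_mul_nonneg_right this hpx
  have hend : ∀ ε : ℝ, ε ^ 2 = 1 → ε ∉ R → ε ∈ s → 0 ≤ moment (Lagrange.basis s id ε) := by
    intro ε hε hεR hεs
    have hpos : ∀ y ∈ Set.Icc (-1 : ℝ) 1, 0 ≤ 1 + ε * y := by
      intro y hy
      have := abs_le.1 ((sq_le_one_iff_abs_le_one (ε * y)).1 (by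
        rw [mul_pow, hε, one_mul]
        exact (sq_le_one_iff_abs_le_one y).2 (abs_le.2 hy)))
      linarith [this.1]
    refine hweight ε hεs ((1 + C ε * X) * Lagrange.nodal R id ^ 2) ?_ ?_ ?_ ?_
    · have h2 : (1 + C ε * X : ℝ[X]).natDegree ≤ 1 := by compute_degree
      have h3 : (Lagrange.nodal R (id : ℝ → ℝ) ^ 2).natDegree ≤ 2 * (2 * k) := by
        rw [natDegree_pow, Lagrange.natDegree_nodal, hcard]
      have := natDegree_mul_le_of_le h2 h3
      omega
    · have h2 : eval ε (Lagrange.nodal R (id : ℝ → ℝ)) ≠ 0 :=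
        Lagrange.eval_nodal_not_at_node fun i hi h => hεR (by rw [h]; exact hi)
      have h3 : (1 + ε * ε : ℝ) = 2 := by linarith [pow_two ε]
      simp only [eval_mul, eval_add, eval_one, eval_C, eval_X, eval_pow, h3]
      positivity
    · intro y hy hne
      rcases eq_or_ne (y ^ 2) 1 with hy2 | hy2
      · have : (y - ε) * (1 + ε * y) = 0 := by linear_combination ε * hy2 - y * hε
        have := (mul_eq_zero.1 this).resolve_left (sub_ne_zero.2 hne)
        simp [this]
      · have hyR : y ∈ R := by
          rcases Finset.mem_insert.1 hy with rfl | hy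
          · norm_num at hy2
          · rcases Finset.mem_insert.1 hy with rfl | hy
            · norm_num at hy2
            · exact hy
        have : eval y (Lagrange.nodal R (id : ℝ → ℝ)) = 0 :=
          Lagrange.eval_nodal_at_node (v := (id : ℝ → ℝ)) hyR
        simp [this]
    · intro y hy
      simp only [eval_mul, eval_add, eval_one, eval_C, eval_X, eval_pow]
      exact mul_nonneg (hpos y hy) (sq_nonneg _)
  have hint : ∀ x ∈ R, 0 ≤ moment (Lagrange.basis s id x) := by
    intro x hx
    have hxs : x ∈ s := Finset.mem_insert_of_mem (Finset.mem_insert_of_mem hx)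
    refine hweight x hxs ((1 - X ^ 2) * Lagrange.nodal (R.erase x) id ^ 2) ?_ ?_ ?_ ?_
    · have h2 : (1 - X ^ 2 : ℝ[X]).natDegree ≤ 2 := by compute_degree
      have h3 : (Lagrange.nodal (R.erase x) (id : ℝ → ℝ) ^ 2).natDegree ≤ 2 * (2 * k - 1) := by
        rw [natDegree_pow, Lagrange.natDegree_nodal, Finset.card_erase_of_mem hx, hcard]
      have := natDegree_mul_le_of_le h2 h3
      omega
    · have h2 : eval x (Lagrange.nodal (R.erase x) (id : ℝ → ℝ)) ≠ 0 :=
        Lagrange.eval_nodal_not_at_node fun i hi h => Finset.ne_of_mem_erase hi h.symm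
      have h3 : 0 < 1 - x ^ 2 := sub_pos.2 ((sq_lt_one_iff_abs_lt_one x).2 (hlt hx))
      simp only [eval_mul, eval_sub, eval_one, eval_X, eval_pow]
      positivity
    · intro y hy hne
      rcases Finset.mem_insert.1 hy with rfl | hy
      · simp
      rcases Finset.mem_insert.1 hy with rfl | hy
      · simp
      have : eval y (Lagrange.nodal (R.erase x) (id : ℝ → ℝ)) = 0 :=
        Lagrange.eval_nodal_at_node (v := (id : ℝ → ℝ)) (Finset.mem_erase.2 ⟨hne, hy⟩)
      simp [this]
    · intro y hy
      simp only [eval_mul, eval_sub, eval_one, eval_X, eval_pow]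
      exact mul_nonneg (sub_nonneg.2 ((sq_le_one_iff_abs_le_one y).2 (abs_le.2 hy)))
        (sq_nonneg _)
  rw [quadrature moment s (2 * k) horth (f := f) (by omega)]
  refine Finset.sum_nonneg fun x hx => ?_
  rcases Finset.mem_insert.1 hx with rfl | hx'
  · exact mul_nonneg h1 (hend 1 (by norm_num) hR1 hx)
  rcases Finset.mem_insert.1 hx' with rfl | hx'
  · exact mul_nonneg hneg (hend (-1) (by norm_num) hRn hx)
  · exact mul_nonneg (hc x (hmem.1 hx')) (hint x hx')

/-- The polynomial `Q` with `∑ α_j sin (j (π - t)) = Q(cos t) sin t`. -/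
noncomputable def sinePoly {N : ℕ} (α : Fin N → ℝ) : ℝ[X] :=
  ∑ j : Fin N, C (α j * (-1) ^ (j : ℕ)) * U ℝ (j : ℕ)

theorem sum_sin_pi_sub {N : ℕ} (α : Fin N → ℝ) (t : ℝ) :
    ∑ j : Fin N, α j * sin (((j : ℕ) + 1) * (π - t)) = (sinePoly α).eval (cos t) * sin t := by
  rw [sinePoly, eval_finsetSum, Finset.sum_mul]
  refine Finset.sum_congr rfl fun j _ => ?_
  have h := sin_nat_mul_pi_sub (((j : ℕ) + 1) * t) ((j : ℕ) + 1)
  push_cast at h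
  rw [eval_mul, eval_C, mul_assoc, U_real_cos, mul_sub, h, pow_succ]
  push_cast
  ring

theorem sum_sin_nonneg_iff {N : ℕ} (α : Fin N → ℝ) :
    (∀ t ∈ Set.Icc (0 : ℝ) π, 0 ≤ ∑ j : Fin N, α j * sin (((j : ℕ) + 1) * t)) ↔
      ∀ x ∈ Set.Icc (-1 : ℝ) 1, 0 ≤ (sinePoly α).eval x := by
  constructor
  · intro h
    have hcl : IsClosed {x : ℝ | 0 ≤ (sinePoly α).eval x} :=
      isClosed_le continuous_const (sinePoly α).continuous
    have hsub : Set.Ioo (-1 : ℝ) 1 ⊆ {x : ℝ | 0 ≤ (sinePoly α).eval x} := by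
      intro x hx
      have h0 := h (π - arccos x)
        ⟨sub_nonneg.2 (arccos_le_pi x), sub_le_self _ (arccos_nonneg x)⟩
      rw [sum_sin_pi_sub, cos_arccos hx.1.le hx.2.le, sin_arccos] at h0
      exact nonneg_of_mul_nonneg_left h0 (sqrt_pos.2 (by nlinarith [hx.1, hx.2]))
    have := closure_minimal hsub hcl
    rwa [closure_Ioo (by norm_num)] at this
  · intro h t ht
    have h0 := sum_sin_pi_sub α (π - t)
    rw [sub_sub_cancel] at h0
    rw [h0]
    exact mul_nonneg (h _ ⟨neg_one_le_cos _, cos_le_one _⟩)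
      (sin_nonneg_of_nonneg_of_le_pi (by linarith [ht.2]) (by linarith [ht.1]))

theorem sinePoly_comp {N : ℕ} (α : Fin N → ℝ) (p : ℝ[X]) :
    (sinePoly α).comp p = ∑ j : Fin N, C (α j * (-1) ^ (j : ℕ)) * (U ℝ (j : ℕ)).comp p := by
  rw [sinePoly, ← coe_compRingHom_apply, map_sum]
  simp

theorem moment_sinePoly_comp {N : ℕ} (α : Fin N → ℝ) :
    moment ((sinePoly α).comp (2 * X ^ 2 - 1)) = ∑ j, α j := by
  rw [sinePoly_comp, map_sum]
  refine Finset.sum_congr rfl fun j _ => ?_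
  rw [moment_C_mul, moment_U_comp, mul_assoc, ← mul_pow]
  simp

theorem moment_X_sq_mul_sinePoly_comp {N : ℕ} (hN : 0 < N) (α : Fin N → ℝ) :
    moment (X ^ 2 * (sinePoly α).comp (2 * X ^ 2 - 1)) = α ⟨0, hN⟩ / 4 := by
  rw [sinePoly_comp, Finset.mul_sum, map_sum, Finset.sum_eq_single ⟨0, hN⟩]
  · rw [mul_left_comm, moment_C_mul, moment_X_sq_mul_U_comp]
    simp [div_eq_mul_inv]
  · intro j _ hj
    rw [mul_left_comm, moment_C_mul, moment_X_sq_mul_U_comp,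
      if_neg fun h => hj (Fin.ext h), mul_zero]
  · simp

theorem natDegree_sinePoly_le {N : ℕ} (α : Fin N → ℝ) : (sinePoly α).natDegree ≤ N - 1 := by
  refine natDegree_sum_le_of_forall_le _ _ fun j _ => (natDegree_C_mul_le _ _).trans ?_
  rw [natDegree_U_natCast]
  omega

theorem exists_sinePoly_eq {N : ℕ} {Q : ℝ[X]} (hQ : Q.degree < N) :
    ∃ α : Fin N → ℝ, sinePoly α = Q := by
  obtain ⟨c, hc⟩ := exists_eq_sum_U N hQ
  refine ⟨fun j => c j * (-1) ^ (j : ℕ), ?_⟩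
  rw [hc, sinePoly, Finset.sum_range fun j => C (c j) * U ℝ j]
  refine Finset.sum_congr rfl fun j _ => ?_
  rw [mul_assoc, ← mul_pow]
  simp

theorem natDegree_comp_two_mul_X_sq_sub_one_le (p : ℝ[X]) :
    (p.comp (2 * X ^ 2 - 1)).natDegree ≤ p.natDegree * 2 :=
  natDegree_comp_le.trans (Nat.mul_le_mul_left _ (by compute_degree))

/-- `ν² ∑ α_j ≤ α_1 / 4` for nonnegative sine polynomials of even length `2k`. -/
theorem sq_mul_sum_le {k : ℕ} (hk : 0 < 2 * k) {ν : ℝ} (hν0 : 0 < ν)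
    (hν : (derivative (U ℝ (2 * k + 1))).eval ν = 0)
    (hνleast : ∀ x : ℝ, 0 < x → x < ν → (derivative (U ℝ (2 * k + 1))).eval x ≠ 0)
    {α : Fin (2 * k) → ℝ} (hα : ∀ x ∈ Set.Icc (-1 : ℝ) 1, 0 ≤ (sinePoly α).eval x) :
    ν ^ 2 * ∑ j, α j ≤ α ⟨0, hk⟩ / 4 := by
  have hν1 := abs_lt_one_of_derivative_U_eval_eq_zero hν
  rw [abs_of_pos hν0] at hν1
  have hle : ∀ x, (derivative (U ℝ (2 * k + 1))).eval x = 0 → ν ≤ |x| := by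
    intro x hx
    by_contra! h
    have hx0 : x ≠ 0 := by
      rintro rfl
      exact derivative_U_eval_zero_ne_zero k hx
    refine hνleast |x| (abs_pos.2 hx0) h ?_
    rcases abs_choice x with h' | h' <;> rw [h']
    · exact hx
    · rwa [derivative_U_eval_neg]
  have hF : ∀ x : ℝ, |x| ≤ 1 → 0 ≤ ((sinePoly α).comp (2 * X ^ 2 - 1)).eval x := by
    intro x hx
    have := (sq_le_one_iff_abs_le_one x).2 hx
    have h2 := hα (2 * x ^ 2 - 1) ⟨by linarith [sq_nonneg x], by linarith⟩
    simpa using h2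
  have hdeg : ((X ^ 2 - C (ν ^ 2)) * (sinePoly α).comp (2 * X ^ 2 - 1)).natDegree
      < 2 * (2 * k + 1) := by
    have h1 : (X ^ 2 - C (ν ^ 2) : ℝ[X]).natDegree ≤ 2 := by compute_degree
    have h2 := natDegree_mul_le_of_le h1
      (natDegree_comp_two_mul_X_sq_sub_one_le (sinePoly α))
    have h3 := natDegree_sinePoly_le α
    omega
  have hnn : ∀ x : ℝ, |x| ≤ 1 → ν ≤ |x| →
      0 ≤ ((X ^ 2 - C (ν ^ 2)) * (sinePoly α).comp (2 * X ^ 2 - 1)).eval x := by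
    intro x hx hx'
    rw [eval_mul]
    refine mul_nonneg ?_ (hF x hx)
    simp only [eval_sub, eval_pow, eval_X, eval_C]
    rw [sub_nonneg, ← sq_abs x]
    exact pow_le_pow_left₀ hν0.le hx' 2
  have h := moment_nonneg_of_nonneg_at_nodes (by omega) hdeg
    (hnn 1 (by simp) (by simpa using hν1.le))
    (hnn (-1) (by simp) (by simpa using hν1.le))
    (fun x hx => hnn x (abs_lt_one_of_derivative_U_eval_eq_zero hx).le (hle x hx))
  rw [sub_mul, map_sub, moment_C_mul, moment_X_sq_mul_sinePoly_comp hk, moment_sinePoly_comp] at h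
  linarith

theorem exists_extremal {k : ℕ} (hk : 0 < 2 * k) {ν : ℝ}
    (hν : (derivative (U ℝ (2 * k + 1))).eval ν = 0) :
    ∃ α : Fin (2 * k) → ℝ, (∀ x ∈ Set.Icc (-1 : ℝ) 1, 0 ≤ (sinePoly α).eval x) ∧
      α ⟨0, hk⟩ / 4 = ν ^ 2 * ∑ j, α j ∧ 0 < ∑ j, α j := by
  have hroot : (halfDerivative k).IsRoot (2 * ν ^ 2 - 1) := by
    simpa [derivative_U_two_mul_add_one, IsRoot.def] using hν
  obtain ⟨K, hK⟩ := dvd_iff_isRoot.2 hroot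
  have hP0 : halfDerivative k ≠ 0 := fun h =>
    halfDerivative_eval_neg_one_ne_zero k (by rw [h, eval_zero])
  have hK0 : K ≠ 0 := by
    rintro rfl
    exact hP0 (by rw [hK, mul_zero])
  have hKdeg : K.natDegree + 1 ≤ k := by
    have h := natDegree_halfDerivative_le k
    rw [hK, natDegree_mul (X_sub_C_ne_zero _) hK0, natDegree_X_sub_C] at h
    omega
  have hQdeg : ((1 - X) * K ^ 2).natDegree < 2 * k := by
    have h1 : (1 - X : ℝ[X]).natDegree ≤ 1 := by compute_degree
    have h2 := natDegree_mul_le_of_le h1 (natDegree_pow_le (p := K) (n := 2))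
    omega
  obtain ⟨α, hα⟩ := exists_sinePoly_eq (N := 2 * k) (Q := (1 - X) * K ^ 2)
    (degree_le_natDegree.trans_lt (by exact_mod_cast hQdeg))
  have hnn : ∀ x ∈ Set.Icc (-1 : ℝ) 1, 0 ≤ (sinePoly α).eval x := by
    intro x hx
    rw [hα]
    simp only [eval_mul, eval_sub, eval_one, eval_X, eval_pow]
    exact mul_nonneg (by linarith [hx.2]) (sq_nonneg _)
  refine ⟨α, hnn, ?_, ?_⟩
  · have hg : ((K.comp (2 * X ^ 2 - 1)).natDegree : ℤ) < (2 * k + 1 : ℤ) - 1 := by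
      have := natDegree_comp_two_mul_X_sq_sub_one_le K
      omega
    have h := moment_one_sub_X_sq_mul_derivative_U_mul hg
    have he : (1 - X ^ 2) * derivative (U ℝ (2 * k + 1)) * K.comp (2 * X ^ 2 - 1)
        = X ^ 2 * (sinePoly α).comp (2 * X ^ 2 - 1)
          - C (ν ^ 2) * (sinePoly α).comp (2 * X ^ 2 - 1) := by
      rw [hα, derivative_U_two_mul_add_one, hK]
      simp [C_ofNat]
      ring
    rw [he, map_sub, moment_C_mul, moment_X_sq_mul_sinePoly_comp hk, moment_sinePoly_comp] at h
    linarith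
  · rw [← moment_sinePoly_comp]
    refine moment_pos (fun x hx => ?_) ?_
    · have := (sq_le_one_iff_abs_le_one x).2 (abs_le.2 hx)
      have h2 := hnn (2 * x ^ 2 - 1) ⟨by linarith [sq_nonneg x], by linarith⟩
      simpa using h2
    · have hKe : K.eval (-1) ≠ 0 := fun h =>
        halfDerivative_eval_neg_one_ne_zero k (by rw [hK, eval_mul, h, mul_zero])
      have : 0 < (1 - (-1 : ℝ)) * K.eval (-1) ^ 2 := by positivity
      simpa [hα] using this

/-- The trigonometric form of `U'_{2k+1}` under the substitution `x = sin s`. -/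
theorem cos_pow_mul_derivative_U_sin (k : ℕ) (s : ℝ) :
    (-1) ^ k * (2 * cos s ^ 3 * (derivative (U ℝ (2 * k + 1))).eval (sin s))
      = ((2 * k : ℝ) + 3) * cos ((2 * k + 1) * s) + ((2 * k : ℝ) + 1) * cos ((2 * k + 3) * s) := by
  have key : ∀ j : ℕ, (U ℝ (2 * j)).eval (sin s) * cos s = (-1) ^ j * cos ((2 * j + 1) * s) := by
    intro j
    have h := U_real_cos (π / 2 - s) (2 * j)
    rw [cos_pi_div_two_sub, sin_pi_div_two_sub] at h
    rw [h, ← cos_pi_div_two_sub]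
    push_cast
    rw [show π / 2 - (2 * j + 1) * (π / 2 - s) = (2 * j + 1) * s - j * π by ring,
      cos_sub_nat_mul_pi]
  have h := congrArg (eval (sin s)) (two_mul_one_sub_X_sq_mul_derivative_U (2 * k + 1))
  have h1 := key k
  have h2 := key (k + 1)
  rw [show (2 * k + 1 - 1 : ℤ) = 2 * k by ring, show (2 * k + 1 + 1 : ℤ) = 2 * (k + 1) by ring] at h
  simp only [eval_mul, eval_sub, eval_add, eval_one, eval_X, eval_pow, eval_ofNat,
    eval_intCast] at h
  push_cast at h h1 h2
  rw [pow_succ, show (2 * ((k : ℝ) + 1) + 1) * s = (2 * k + 3) * s by ring] at h2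
  have hs : ((-1 : ℝ) ^ k) * (-1) ^ k = 1 := by rw [← mul_pow]; simp
  have hc := sin_sq_add_cos_sq s
  rw [show 1 - sin s ^ 2 = cos s ^ 2 by linarith] at h
  linear_combination ((-1) ^ k * cos s) * h + (-1) ^ k * (2 * k + 3) * h1
    - (-1) ^ k * (2 * k + 1) * h2
    + ((2 * k + 3) * cos ((2 * k + 1) * s) + (2 * k + 1) * cos ((2 * k + 3) * s)) * hs

theorem least_root_eq_sin {k : ℕ} {ν ϑ : ℝ} (hν0 : 0 < ν)
    (hν : (derivative (U ℝ (2 * k + 1))).eval ν = 0)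
    (hνleast : ∀ x : ℝ, 0 < x → x < ν → (derivative (U ℝ (2 * k + 1))).eval x ≠ 0)
    (hϑ0 : 0 < ϑ)
    (hϑ : ((2 * k : ℝ) + 3) * cos ((2 * k + 1) * ϑ)
      + ((2 * k : ℝ) + 1) * cos ((2 * k + 3) * ϑ) = 0)
    (hϑleast : ∀ s : ℝ, 0 < s → s < ϑ → ((2 * k : ℝ) + 3) * cos ((2 * k + 1) * s)
      + ((2 * k : ℝ) + 1) * cos ((2 * k + 3) * s) ≠ 0) :
    ν = sin ϑ := by
  have hν1 := abs_lt_one_of_derivative_U_eval_eq_zero hν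
  rw [abs_of_pos hν0] at hν1
  have hle : ϑ ≤ arcsin ν := by
    by_contra! h
    refine hϑleast _ (arcsin_pos.2 hν0) h ?_
    rw [← cos_pow_mul_derivative_U_sin, sin_arcsin (by linarith) hν1.le, hν]
    simp
  have hlt : ϑ < π / 2 := hle.trans_lt (arcsin_lt_pi_div_two.2 hν1)
  have hcos : 0 < cos ϑ := cos_pos_of_mem_Ioo ⟨by linarith, hlt⟩
  have hsin : 0 < sin ϑ := sin_pos_of_pos_of_lt_pi hϑ0 (by linarith)
  refine le_antisymm ?_ ?_
  · by_contra! h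
    refine hνleast _ hsin h ?_
    rw [← cos_pow_mul_derivative_U_sin] at hϑ
    have h1 : ((-1 : ℝ) ^ k) ≠ 0 := by simp
    simpa [h1, hcos.ne'] using hϑ
  · exact (le_arcsin_iff_sin_le ⟨by linarith, hlt.le⟩ ⟨by linarith, hν1.le⟩).1 hle

end ChebyshevSine

theorem stmt14 (N : ℕ) (hN : 0 < N) (hNeven : Even N)
    (ν : ℝ) (hν0 : 0 < ν) (hνroot : Ucheb' (N + 1) ν = 0)
    (hνleast : ∀ x : ℝ, 0 < x → x < ν → Ucheb' (N + 1) x ≠ 0)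
    (ϑ : ℝ) (hϑ0 : 0 < ϑ)
    (hϑroot : ((N : ℝ) + 3) * Real.cos ((N + 1) * ϑ) + ((N : ℝ) + 1) * Real.cos ((N + 3) * ϑ) = 0)
    (hϑleast : ∀ s : ℝ, 0 < s → s < ϑ →
      ((N : ℝ) + 3) * Real.cos ((N + 1) * s) + ((N : ℝ) + 1) * Real.cos ((N + 3) * s) ≠ 0) :
    IsGreatest ((fun α : Fin N → ℝ => ∑ j : Fin N, α j) '' sineSet N) (1 / (4 * ν ^ 2))
      ∧ 1 / (4 * ν ^ 2) = (1 / 4) * (1 / Real.sin ϑ ^ 2) := by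
  obtain ⟨k, rfl⟩ := hNeven.exists_two_nsmul
  rw [smul_eq_mul] at *
  simp only [Ucheb', Nat.cast_mul, Nat.cast_ofNat] at hνroot hνleast hϑroot hϑleast
  refine ⟨⟨?_, ?_⟩, ?_⟩
  · obtain ⟨α, hα, hα1, hpos⟩ := ChebyshevSine.exists_extremal hN hνroot
    have h0 : 0 < α ⟨0, hN⟩ := by
      have : 0 < ν ^ 2 * ∑ j, α j := by positivity
      linarith
    refine ⟨fun j => (α ⟨0, hN⟩)⁻¹ * α j, ⟨fun i hi => ?_, fun t ht => ?_⟩, ?_⟩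
    · rw [show i = ⟨0, hN⟩ from Fin.ext hi]
      exact inv_mul_cancel₀ h0.ne'
    · have := (ChebyshevSine.sum_sin_nonneg_iff α).2 hα t ht
      simp only [mul_assoc, ← Finset.mul_sum]
      exact mul_nonneg (inv_nonneg.2 h0.le) this
    · simp only [← Finset.mul_sum]
      field_simp
      linarith
  · rintro _ ⟨α, ⟨hα1, hα⟩, rfl⟩
    have h := ChebyshevSine.sq_mul_sum_le hN hν0 hνroot hνleast
      ((ChebyshevSine.sum_sin_nonneg_iff α).1 hα)
    rw [hα1 ⟨0, hN⟩ rfl] at h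
    have : 0 < ν ^ 2 := by positivity
    rw [le_div_iff₀ (by positivity)]
    simp only
    linarith
  · rw [← ChebyshevSine.least_root_eq_sin hν0 hνroot hνleast hϑ0 hϑroot hϑleast]
    field_simp
end

section
/- Let N ≥ 3 be a positive integer. Consider the set S_N of coefficient vectors (α_1,…,α_N) ∈ ℝ^N with α_1 = 1 such that ∑_{j=1}^N α_j sin(jt) ≥ 0 for all t ∈ [0, π]. Then the maximum of ∑_{j=1}^N |α_j| over S_N and the maximum of ∑_{j=1}^N α_j over S_N are both attained and are equal; that is, the extremal coefficient vector for the absolute-sum problem can be chosen with all coefficients nonnegative, and the two extremal values coincide. -/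
open Real

namespace SinePolynomial

open Polynomial

/-- The Chebyshev polynomial of the second kind, indexed by natural numbers. -/
noncomputable def u (n : ℕ) : ℝ[X] := Chebyshev.U ℝ n

/-- The Chebyshev polynomial of the first kind, indexed by natural numbers. -/
noncomputable def t (n : ℕ) : ℝ[X] := Chebyshev.T ℝ n

@[simp] lemma u_zero : u 0 = 1 := by simp [u]

@[simp] lemma u_one : u 1 = 2 * X := by simp [u]

lemma u_add_two (n : ℕ) : u (n + 2) = 2 * X * u (n + 1) - u n := by
  simp [u, Chebyshev.U_add_two]

lemma u_succ_mul_u_succ (a b : ℕ) : u (a + 1) * u (b + 1) = u a * u b + u (a + b + 2) := by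
  induction a using Nat.twoStepInduction with
  | zero => simp [u_add_two]
  | one =>
    have h1 := u_add_two 0
    have h2 := u_add_two b
    have h3 := u_add_two (b + 1)
    rw [show 1 + b + 2 = b + 1 + 2 by ring]
    simp only [u_zero, u_one, zero_add, Nat.reduceAdd] at *
    linear_combination u (b + 1) * h1 - h3 - 2 * X * h2
  | more n ih1 ih2 =>
    have h1 := u_add_two (n + 1)
    have h2 := u_add_two n
    have h3 := u_add_two (n + b + 2)
    rw [show n + 1 + b + 2 = n + b + 2 + 1 by ring] at ih2
    rw [show n + 2 + b + 2 = n + b + 2 + 2 by ring]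
    linear_combination u (b + 1) * h1 - u b * h2 - h3 + 2 * X * ih2 - ih1

lemma u_succ_mul_u_add (a d : ℕ) :
    u (a + 1) * u (a + 1 + d) = u a * u (a + d + 2) + u d := by
  induction a with
  | zero =>
    have := u_add_two d
    simp only [zero_add, u_zero, u_one, add_comm 1 d]
    linear_combination -this
  | succ n ih =>
    have h1 := u_succ_mul_u_succ (n + 1) (n + 1 + d)
    have h2 := u_succ_mul_u_succ n (n + d + 2)
    rw [show n + 1 + 1 + d = n + 1 + d + 1 by ring, show n + 1 + d + 2 = n + d + 2 + 1 by ring]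
    rw [show n + 1 + (n + 1 + d) + 2 = n + (n + d + 2) + 2 by ring] at h1
    linear_combination h1 - h2 + ih

lemma one_sub_X_sq_mul_u (n : ℕ) : 2 * (1 - X ^ 2) * u n = t n - t (n + 2) := by
  have h1 := Chebyshev.one_sub_X_sq_mul_U_eq_pol_in_T ℝ n
  have h2 := Chebyshev.T_add_two ℝ n
  simp only [u, t]
  push_cast
  linear_combination 2 * h1 - h2

lemma two_mul_t_mul_t (k d : ℕ) : 2 * t k * t (k + d) = t (2 * k + d) + t d := by
  have h := Chebyshev.T_mul_T ℝ (k + d) k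
  simp only [t]
  push_cast
  rw [show (k : ℤ) + d - k = d by ring, show (k : ℤ) + d + k = 2 * k + d by ring] at h
  linear_combination h

lemma isUnit_leadingCoeff (S : Sequence ℝ) (i : ℕ) : IsUnit (S i).leadingCoeff :=
  (leadingCoeff_ne_zero.2 (S.ne_zero i)).isUnit

lemma exists_eq_sum_smul (S : Sequence ℝ) {d : ℕ} {p : ℝ[X]} (hp : p ∈ degreeLT ℝ d) :
    ∃ a : ℕ → ℝ, p = ∑ k ∈ Finset.range d, a k • S k := by
  rw [← S.span_degreeLT (fun i _ => isUnit_leadingCoeff S i)] at hp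
  have h2 : S '' Set.Iio d = S '' (Finset.range d : Set ℕ) := by simp
  rw [h2, Submodule.mem_span_image_finset_iff_exists_fun] at hp
  obtain ⟨c, hc⟩ := hp
  refine ⟨fun k => if h : k ∈ Finset.range d then c ⟨k, h⟩ else 0, ?_⟩
  refine hc.symm.trans (Eq.trans ?_ (Finset.sum_coe_sort (Finset.range d) _))
  exact Finset.sum_congr rfl fun k _ => by simp only [dif_pos k.2]

/-- The Chebyshev polynomials of the second kind as a polynomial sequence. -/
noncomputable def uSequence : Sequence ℝ := ⟨u, fun n => by simp [u]⟩

/-- The Chebyshev polynomials of the first kind as a polynomial sequence. -/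
noncomputable def tSequence : Sequence ℝ := ⟨t, fun n => by simp [t, Chebyshev.degree_T]⟩

/-- The coefficient of `u n` in the expansion of a polynomial along the sequence `u`. -/
noncomputable def uCoeff (n : ℕ) : ℝ[X] →ₗ[ℝ] ℝ :=
  (uSequence.basis (isUnit_leadingCoeff uSequence)).coord n

lemma uCoeff_u (n k : ℕ) : uCoeff n (u k) = if n = k then 1 else 0 := by
  have : u k = uSequence.basis (isUnit_leadingCoeff uSequence) k := by
    rw [Sequence.basis_eq_self]; rfl
  rw [uCoeff, this, Module.Basis.coord_apply, Module.Basis.repr_self, Finsupp.single_apply]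
  simp [eq_comm]

lemma eq_sum_uCoeff {N : ℕ} {P : ℝ[X]} (hP : P ∈ degreeLT ℝ N) :
    P = ∑ n ∈ Finset.range N, uCoeff n P • u n := by
  obtain ⟨a, rfl⟩ := exists_eq_sum_smul uSequence hP
  refine Finset.sum_congr rfl fun n hn => ?_
  change _ • u n = _
  congr 1
  have : ∀ k, uSequence k = u k := fun _ => rfl
  simp only [map_sum, map_smul, this, uCoeff_u, smul_eq_mul]
  simp [Finset.mem_range.1 hn]

lemma uCoeff_u_mul_u_nonneg (n a b : ℕ) : 0 ≤ uCoeff n (u a * u b) := by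
  have hu : ∀ k, 0 ≤ uCoeff n (u k) := fun k => by rw [uCoeff_u]; split_ifs <;> norm_num
  induction a generalizing b with
  | zero => simpa using hu b
  | succ a ih =>
    cases b with
    | zero => simpa using hu (a + 1)
    | succ b =>
      rw [u_succ_mul_u_succ, map_add]
      exact add_nonneg (ih b) (hu _)

lemma uCoeff_zero_u_mul_u (a b : ℕ) : uCoeff 0 (u a * u b) = if a = b then 1 else 0 := by
  induction a generalizing b with
  | zero => simpa using uCoeff_u 0 b
  | succ a ih =>
    cases b with
    | zero => simpa using uCoeff_u 0 (a + 1)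
    | succ b => simp [u_succ_mul_u_succ, ih, uCoeff_u]

lemma sum_uCoeff_u_mul_u {N a b : ℕ} (h : a + b < N) :
    ∑ n ∈ Finset.range N, uCoeff n (u a * u b) = min a b + 1 := by
  have hu : ∀ k < N, ∑ n ∈ Finset.range N, uCoeff n (u k) = 1 := fun k hk => by
    simp [uCoeff_u, hk]
  induction a generalizing b with
  | zero => simpa using hu b (by omega)
  | succ a ih =>
    cases b with
    | zero => simpa using hu (a + 1) (by omega)
    | succ b =>
      simp only [u_succ_mul_u_succ, map_add, Finset.sum_add_distrib]
      rw [ih (by omega), hu _ (by omega)]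
      push_cast
      rw [min_add_add_right]

/-- The alternating sums `∑ k ≤ a, (-1) ^ (a - k) * (k + 1) * u k`, which are orthogonal for the
weight `(1 + x) * √(1 - x ^ 2)`. -/
noncomputable def s : ℕ → ℝ[X]
  | 0 => 1
  | a + 1 => (a + 2 : ℝ) • u (a + 1) - s a

lemma degree_u (n : ℕ) : (u n).degree = n := by simp [u]

lemma degree_s (n : ℕ) : (s n).degree = n := by
  induction n with
  | zero => simp [s]
  | succ a ih =>
    have h : ((a + 2 : ℝ) • u (a + 1)).degree = ((a + 1 : ℕ) : WithBot ℕ) := by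
      rw [smul_eq_C_mul, degree_C_mul (by positivity), degree_u]
    rw [s, degree_sub_eq_left_of_degree_lt, h]
    rw [h, ih]
    norm_cast
    omega

lemma one_add_X_mul_s (b : ℕ) :
    2 * (1 + X) * s b = (b + 1 : ℝ) • u (b + 1) + (b + 2 : ℝ) • u b := by
  induction b with
  | zero => simp [s, smul_eq_C_mul, C_ofNat]; ring
  | succ b ih =>
    have h := u_add_two b
    simp only [s, smul_eq_C_mul, map_add, map_natCast, map_ofNat, map_one] at *
    push_cast
    linear_combination -ih + (b + 2 : ℝ[X]) * (-h)

lemma uCoeff_zero_s_mul_u {a b : ℕ} (h : a < b) : uCoeff 0 (s a * u b) = 0 := by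
  induction a with
  | zero => simp [s, uCoeff_u, h.ne]
  | succ a ih =>
    rw [s, sub_mul, smul_mul_assoc, map_sub, map_smul, ih (by omega), uCoeff_zero_u_mul_u,
      if_neg h.ne]
    simp

lemma uCoeff_zero_weighted_s {a b : ℕ} (h : a ≠ b) :
    uCoeff 0 ((1 + X) * s a * s b) = 0 := by
  wlog hab : a < b generalizing a b
  · rw [mul_right_comm]
    exact this h.symm (by omega)
  have e : (1 + X) * s a * s b = (2⁻¹ : ℝ) • (s a * (2 * (1 + X) * s b)) := by
    rw [show s a * (2 * (1 + X) * s b) = (2 : ℝ) • ((1 + X) * s a * s b) by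
      rw [smul_eq_C_mul, map_ofNat]; ring, smul_smul]
    norm_num
  rw [e, one_add_X_mul_s, mul_add, mul_smul_comm, mul_smul_comm]
  simp [uCoeff_zero_s_mul_u hab, uCoeff_zero_s_mul_u (show a < b + 1 by omega)]

lemma uCoeff_s_mul_nonneg (n : ℕ) {a b : ℕ} (h : a ≤ b) :
    0 ≤ uCoeff n (s a * ((b + 1 : ℝ) • u (b + 1) + (b + 2 : ℝ) • u b)) := by
  have hu : ∀ k, 0 ≤ uCoeff n (u k) := fun k => by rw [uCoeff_u]; split_ifs <;> norm_num
  have huu := uCoeff_u_mul_u_nonneg n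
  have step : ∀ a d : ℕ, b = a + 1 + d →
      0 ≤ uCoeff n (((a + 2 : ℝ) • u (a + 1) - (a + 1 : ℝ) • u a) *
        ((b + 1 : ℝ) • u (b + 1) + (b + 2 : ℝ) • u b)) := by
    rintro a d rfl
    have h1 := u_succ_mul_u_succ a (a + 1 + d)
    have h2 := u_succ_mul_u_add a d
    have e : (((a + 2 : ℝ) • u (a + 1) - (a + 1 : ℝ) • u a) *
        ((((a + 1 + d : ℕ) : ℝ) + 1) • u (a + 1 + d + 1) +
          (((a + 1 + d : ℕ) : ℝ) + 2) • u (a + 1 + d))) =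
        ((a + 2) * (a + d + 2) : ℝ) • u (a + (a + 1 + d) + 2) +
        (d + 1 : ℝ) • (u a * u (a + 1 + d)) +
        ((a + 1) * (a + d + 2) : ℝ) • u d +
        ((a + 2) * (a + d + 3) - (a + 1) * (a + d + 2) : ℝ) • (u (a + 1) * u (a + 1 + d)) := by
      rw [show a + d + 2 = a + 1 + d + 1 by ring] at h2
      simp only [smul_eq_C_mul, map_add, map_sub, map_mul, map_natCast, map_ofNat, map_one]
      push_cast
      linear_combination (a + 2 : ℝ[X]) * (a + d + 2) * h1 + (a + 1 : ℝ[X]) * (a + d + 2) * h2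
    rw [e]
    simp only [map_add, map_smul, smul_eq_mul]
    have h3 : (0 : ℝ) ≤ (a + 2) * (a + d + 3) - (a + 1) * (a + d + 2) := by
      have : (0 : ℝ) ≤ a := by positivity
      have : (0 : ℝ) ≤ d := by positivity
      nlinarith
    have := hu (a + (a + 1 + d) + 2)
    have := huu a (a + 1 + d)
    have := hu d
    have := huu (a + 1) (a + 1 + d)
    positivity
  induction a using Nat.twoStepInduction with
  | zero =>
    simp only [s, one_mul, map_add, map_smul, smul_eq_mul]
    have := hu b
    have := hu (b + 1)
    positivity
  | one =>
    have := step 0 (b - 1) (by omega)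
    simpa [s] using this
  | more a ih1 _ =>
    have h1 := step (a + 1) (b - (a + 2)) (by omega)
    have h2 := ih1 (by omega)
    rw [show s (a + 2) = ((a + 1 : ℕ) + 2 : ℝ) • u (a + 1 + 1) -
      ((a + 1 : ℕ) + 1 : ℝ) • u (a + 1) + s a by
        simp only [s]; push_cast; rw [show (a : ℝ) + 1 + 1 = a + 2 by ring]; abel, add_mul, map_add]
    exact add_nonneg h1 h2

lemma uCoeff_weighted_s_nonneg (n a b : ℕ) : 0 ≤ uCoeff n ((1 + X) * s a * s b) := by
  wlog hab : a ≤ b generalizing a b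
  · rw [mul_right_comm]
    exact this b a (by omega)
  have e : (2 : ℝ) • ((1 + X) * s a * s b) = s a * (2 * (1 + X) * s b) := by
    rw [smul_eq_C_mul, map_ofNat]; ring
  have h := uCoeff_s_mul_nonneg n hab
  rw [← one_add_X_mul_s, ← e, map_smul, smul_eq_mul] at h
  linarith

/-- The sum of the absolute values of the first `N` coefficients along the sequence `u`. -/
noncomputable def absSum (N : ℕ) (P : ℝ[X]) : ℝ := ∑ n ∈ Finset.range N, |uCoeff n P|

lemma absSum_add_le (N : ℕ) (P Q : ℝ[X]) : absSum N (P + Q) ≤ absSum N P + absSum N Q := by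
  simp only [absSum, map_add, ← Finset.sum_add_distrib]
  exact Finset.sum_le_sum fun n _ => abs_add_le _ _

lemma absSum_smul (N : ℕ) (a : ℝ) (P : ℝ[X]) : absSum N (a • P) = |a| * absSum N P := by
  simp [absSum, abs_mul, Finset.mul_sum]

lemma absSum_sub_le (N : ℕ) (P Q : ℝ[X]) : absSum N (P - Q) ≤ absSum N P + absSum N Q := by
  have h := absSum_add_le N P ((-1 : ℝ) • Q)
  rw [absSum_smul] at h
  simpa [sub_eq_add_neg] using h

lemma absSum_sum_le {ι : Type*} (N : ℕ) (A : Finset ι) (f : ι → ℝ[X]) :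
    absSum N (∑ i ∈ A, f i) ≤ ∑ i ∈ A, absSum N (f i) := by
  classical
  induction A using Finset.induction_on with
  | empty => simp [absSum]
  | insert i A hi ih =>
    rw [Finset.sum_insert hi, Finset.sum_insert hi]
    exact (absSum_add_le _ _ _).trans (by gcongr)

lemma absSum_u_le (N k : ℕ) : absSum N (u k) ≤ 1 := by
  simp only [absSum, uCoeff_u]
  rw [Finset.sum_congr rfl (g := fun n => if n = k then (1 : ℝ) else 0)
    fun n _ => by split_ifs <;> simp, Finset.sum_ite_eq']
  split_ifs <;> norm_num

lemma mem_degreeLT_of_natDegree_lt {d : ℕ} {p : ℝ[X]} (h : p.natDegree < d) :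
    p ∈ degreeLT ℝ d :=
  mem_degreeLT.2 (degree_le_natDegree.trans_lt (by exact_mod_cast h))

/-- `M` bounds the sum of the `u`-coefficients of every polynomial of degree less than `N` that is
nonnegative on `[-1, 1]` by `M` times its zeroth coefficient. -/
def BoundsSum (N : ℕ) (M : ℝ) : Prop :=
  ∀ P : ℝ[X], P.natDegree < N → (∀ x ∈ Set.Icc (-1 : ℝ) 1, 0 ≤ P.eval x) →
    ∑ n ∈ Finset.range N, uCoeff n P ≤ M * uCoeff 0 P

lemma absSum_mul_sq_le {N : ℕ} {M : ℝ} (hM : BoundsSum N M) (e : Sequence ℝ) {w : ℝ[X]}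
    (hw : ∀ x ∈ Set.Icc (-1 : ℝ) 1, 0 ≤ w.eval x)
    (hpos : ∀ n k l, 0 ≤ uCoeff n (w * e k * e l))
    (horth : ∀ k l, k ≠ l → uCoeff 0 (w * e k * e l) = 0)
    {p : ℝ[X]} (hp : w.natDegree + 2 * p.natDegree < N) :
    absSum N (w * p ^ 2) ≤ M * uCoeff 0 (w * p ^ 2) := by
  obtain ⟨a, ha⟩ := exists_eq_sum_smul e (mem_degreeLT_of_natDegree_lt p.natDegree.lt_succ_self)
  set R := Finset.range (p.natDegree + 1) with hR
  have expand : ∀ (b : ℕ → ℝ) (n : ℕ), uCoeff n (w * (∑ k ∈ R, b k • e k) ^ 2) =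
      ∑ k ∈ R, ∑ l ∈ R, b k * b l * uCoeff n (w * e k * e l) := fun b n => by
    rw [sq, Finset.sum_mul_sum, Finset.mul_sum, map_sum]
    refine Finset.sum_congr rfl fun k _ => ?_
    rw [Finset.mul_sum, map_sum]
    refine Finset.sum_congr rfl fun l _ => ?_
    rw [show w * (b k • e k * b l • e l) = (b k * b l) • (w * e k * e l) by
      simp only [smul_eq_C_mul, map_mul]; ring, map_smul, smul_eq_mul]
  set q := ∑ k ∈ R, |a k| • e k with hq
  have hqdeg : q.natDegree ≤ p.natDegree := by
    refine natDegree_sum_le_of_forall_le _ _ fun k hk => (natDegree_smul_le _ _).trans ?_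
    rw [e.natDegree_eq]
    have := Finset.mem_range.1 hk
    omega
  have h0 : uCoeff 0 (w * q ^ 2) = uCoeff 0 (w * p ^ 2) := by
    rw [hq]
    conv_rhs => rw [ha]
    rw [expand, expand]
    refine Finset.sum_congr rfl fun k _ => Finset.sum_congr rfl fun l _ => ?_
    rcases eq_or_ne k l with rfl | hkl
    · rw [abs_mul_abs_self]
    · rw [horth k l hkl, mul_zero, mul_zero]
  have hle : absSum N (w * p ^ 2) ≤ ∑ n ∈ Finset.range N, uCoeff n (w * q ^ 2) := by
    refine Finset.sum_le_sum fun n _ => ?_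
    rw [hq]
    conv_lhs => rw [ha]
    rw [expand, expand]
    refine (Finset.abs_sum_le_sum_abs _ _).trans (Finset.sum_le_sum fun k _ => ?_)
    refine (Finset.abs_sum_le_sum_abs _ _).trans (Finset.sum_le_sum fun l _ => ?_)
    rw [abs_mul, abs_mul, abs_of_nonneg (hpos n k l)]
  rw [← h0]
  refine hle.trans (hM _ ?_ fun x hx => ?_)
  · have h1 : (w * q ^ 2).natDegree ≤ w.natDegree + (q ^ 2).natDegree := natDegree_mul_le
    have h2 : (q ^ 2).natDegree ≤ 2 * q.natDegree := natDegree_pow_le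
    omega
  · rw [eval_mul, eval_pow]
    exact mul_nonneg (hw x hx) (sq_nonneg _)

lemma absSum_sq_le {N : ℕ} {M : ℝ} (hM : BoundsSum N M) {p : ℝ[X]} (hp : 2 * p.natDegree < N) :
    absSum N (p ^ 2) ≤ M * uCoeff 0 (p ^ 2) := by
  have h := absSum_mul_sq_le hM uSequence (w := 1) (by simp)
    (fun n k l => by rw [one_mul]; exact uCoeff_u_mul_u_nonneg n k l)
    (fun k l hkl => by rw [one_mul]; exact (uCoeff_zero_u_mul_u k l).trans (if_neg hkl))
    (p := p) (by simpa using hp)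
  simpa using h

/-- The polynomials `s n` as a polynomial sequence. -/
noncomputable def sSequence : Sequence ℝ := ⟨s, degree_s⟩

lemma absSum_one_add_X_mul_sq_le {N : ℕ} {M : ℝ} (hM : BoundsSum N M) {p : ℝ[X]}
    (hp : 1 + 2 * p.natDegree < N) :
    absSum N ((1 + X) * p ^ 2) ≤ M * uCoeff 0 ((1 + X) * p ^ 2) := by
  refine absSum_mul_sq_le hM sSequence (fun x hx => ?_) uCoeff_weighted_s_nonneg
    (fun k l hkl => uCoeff_zero_weighted_s hkl) ?_
  · simp only [eval_add, eval_one, eval_X]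
    linarith [hx.1]
  · have : (1 + X : ℝ[X]).natDegree = 1 := by
      rw [add_comm, ← C_1, natDegree_X_add_C]
    omega

lemma uCoeff_comp_neg_X (n : ℕ) (P : ℝ[X]) : uCoeff n (P.comp (-X)) = (-1) ^ n * uCoeff n P := by
  have hu : ∀ k, (u k).comp (-X) = (-1 : ℝ) ^ k • u k := fun k => by
    induction k using Nat.twoStepInduction with
    | zero => simp
    | one => simp
    | more k ih1 ih2 =>
      rw [u_add_two, sub_comp, mul_comp, mul_comp, ih1, ih2, X_comp, ofNat_comp]
      simp only [smul_eq_C_mul, pow_succ, map_mul, map_neg, map_one]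
      ring
  obtain ⟨a, ha⟩ := exists_eq_sum_smul uSequence
    (mem_degreeLT_of_natDegree_lt P.natDegree.lt_succ_self)
  rw [ha, Polynomial.sum_comp, map_sum, map_sum, Finset.mul_sum]
  refine Finset.sum_congr rfl fun k _ => ?_
  change uCoeff n ((a k • u k).comp (-X)) = _ * uCoeff n (a k • u k)
  rw [smul_comp, hu, map_smul, map_smul, map_smul, uCoeff_u]
  split_ifs with h
  · rw [h]; simp; ring
  · simp

lemma absSum_comp_neg_X (N : ℕ) (P : ℝ[X]) : absSum N (P.comp (-X)) = absSum N P := by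
  simp [absSum, uCoeff_comp_neg_X, abs_mul]

lemma absSum_one_sub_X_mul_sq_le {N : ℕ} {M : ℝ} (hM : BoundsSum N M) {p : ℝ[X]}
    (hp : 1 + 2 * p.natDegree < N) :
    absSum N ((1 - X) * p ^ 2) ≤ M * uCoeff 0 ((1 - X) * p ^ 2) := by
  have h := absSum_one_add_X_mul_sq_le hM (p := p.comp (-X)) (by simpa [natDegree_comp] using hp)
  have e : (1 + X) * (p.comp (-X)) ^ 2 = ((1 - X) * p ^ 2).comp (-X) := by simp
  rwa [e, absSum_comp_neg_X, uCoeff_comp_neg_X, pow_zero, one_mul] at h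

/-- Sums of polynomials `(1 + X) ^ i * (1 - X) ^ j * p ^ 2` of formal degree at most `n`. -/
inductive IsLukacs : ℕ → ℝ[X] → Prop
  | term {n : ℕ} (i j : ℕ) (p : ℝ[X]) (h : i + j + 2 * p.natDegree ≤ n) :
      IsLukacs n ((1 + X) ^ i * (1 - X) ^ j * p ^ 2)
  | add {n : ℕ} {P Q : ℝ[X]} (hP : IsLukacs n P) (hQ : IsLukacs n Q) : IsLukacs n (P + Q)

namespace IsLukacs

lemma mul_term {n m : ℕ} {P : ℝ[X]} (hP : IsLukacs n P) (i j : ℕ) (p : ℝ[X])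
    (h : i + j + 2 * p.natDegree ≤ m) :
    IsLukacs (n + m) ((1 + X) ^ i * (1 - X) ^ j * p ^ 2 * P) := by
  induction hP with
  | term a b q hq =>
    have e : (1 + X) ^ i * (1 - X) ^ j * p ^ 2 * ((1 + X) ^ a * (1 - X) ^ b * q ^ 2) =
        (1 + X) ^ (i + a) * (1 - X) ^ (j + b) * (p * q) ^ 2 := by ring
    rw [e]
    have : (p * q).natDegree ≤ p.natDegree + q.natDegree := natDegree_mul_le
    exact term _ _ _ (by omega)
  | add _ _ ih1 ih2 => rw [mul_add]; exact add ih1 ih2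

lemma mono {n m : ℕ} {P : ℝ[X]} (hP : IsLukacs n P) (h : n ≤ m) : IsLukacs m P := by
  induction hP with
  | term i j q h' => exact term i j q (h'.trans h)
  | add _ _ ih1 ih2 => exact add ih1 ih2

lemma const_mul {n : ℕ} {P : ℝ[X]} (hP : IsLukacs n P) {a : ℝ} (ha : 0 ≤ a) :
    IsLukacs n (C a * P) := by
  have h := hP.mul_term (m := 0) 0 0 (C (√a)) (by simp)
  simpa [← C_pow, Real.sq_sqrt ha] using h

lemma sub_X_mul {n : ℕ} {P : ℝ[X]} (hP : IsLukacs n P) {a : ℝ} (ha : 1 ≤ a) :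
    IsLukacs (n + 1) ((C a - X) * P) := by
  have h1 := (hP.mul_term (m := 1) 1 0 1 (by simp)).const_mul (show 0 ≤ (a - 1) / 2 by linarith)
  have h2 := (hP.mul_term (m := 1) 0 1 1 (by simp)).const_mul (show 0 ≤ (a + 1) / 2 by linarith)
  convert! h1.add h2 using 1
  have e1 : C a = C ((a - 1) / 2) + C ((a + 1) / 2) := by rw [← C_add]; ring_nf
  have e2 : (1 : ℝ[X]) = C ((a + 1) / 2) - C ((a - 1) / 2) := by rw [← C_sub]; ring_nf; simp
  linear_combination P * e1 - X * P * e2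

lemma X_add_mul {n : ℕ} {P : ℝ[X]} (hP : IsLukacs n P) {a : ℝ} (ha : 1 ≤ a) :
    IsLukacs (n + 1) ((C a + X) * P) := by
  have h1 := (hP.mul_term (m := 1) 1 0 1 (by simp)).const_mul (show 0 ≤ (a + 1) / 2 by linarith)
  have h2 := (hP.mul_term (m := 1) 0 1 1 (by simp)).const_mul (show 0 ≤ (a - 1) / 2 by linarith)
  convert! h1.add h2 using 1
  have e1 : C a = C ((a - 1) / 2) + C ((a + 1) / 2) := by rw [← C_add]; ring_nf
  have e2 : (1 : ℝ[X]) = C ((a + 1) / 2) - C ((a - 1) / 2) := by rw [← C_sub]; ring_nf; simp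
  linear_combination P * e1 + X * P * e2

end IsLukacs

/-- If `L * Q` and `L ≠ 0` are nonnegative on `[-1, 1]`, then so is `Q`. -/
lemma eval_nonneg_of_mul {L Q : ℝ[X]} (hL0 : L ≠ 0) (hL : ∀ x ∈ Set.Icc (-1 : ℝ) 1, 0 ≤ L.eval x)
    (hLQ : ∀ x ∈ Set.Icc (-1 : ℝ) 1, 0 ≤ (L * Q).eval x) :
    ∀ x ∈ Set.Icc (-1 : ℝ) 1, 0 ≤ Q.eval x := by
  intro x hx
  have hdense : x ∈ closure (Set.Ioo (-1 : ℝ) 1 \ L.rootSet ℝ) := by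
    have h1 : Dense ((L.rootSet ℝ)ᶜ) := (L.rootSet_finite ℝ).countable.dense_compl ℝ
    have h2 : closure (Set.Ioo (-1 : ℝ) 1) ⊆ closure (Set.Ioo (-1 : ℝ) 1 ∩ (L.rootSet ℝ)ᶜ) :=
      closure_minimal (h1.open_subset_closure_inter isOpen_Ioo) isClosed_closure
    rw [closure_Ioo (by norm_num)] at h2
    exact h2 hx
  have hclosed : IsClosed {y : ℝ | 0 ≤ Q.eval y} := isClosed_le continuous_const Q.continuous
  refine closure_minimal ?_ hclosed hdense
  rintro y ⟨hy, hyL⟩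
  have hy' := Set.Ioo_subset_Icc_self hy
  have hne : L.eval y ≠ 0 := fun h0 => hyL ((mem_rootSet_of_ne hL0).2 (by simpa using h0))
  have h := hLQ y hy'
  rw [eval_mul] at h
  exact nonneg_of_mul_nonneg_right h ((hL y hy').lt_of_ne' hne)

lemma isLukacs_of_nonneg (n : ℕ) (P : ℝ[X]) (hdeg : P.natDegree ≤ n)
    (hP : ∀ x ∈ Set.Icc (-1 : ℝ) 1, 0 ≤ P.eval x) : IsLukacs n P := by
  induction n using Nat.strong_induction_on generalizing P with
  | _ n ih =>
    by_cases h0 : P.natDegree = 0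
    · rw [eq_C_of_natDegree_eq_zero h0] at hP ⊢
      have ha : 0 ≤ P.coeff 0 := by simpa using hP 0 (by norm_num)
      simpa using (IsLukacs.term (n := n) 0 0 1 (by simp)).const_mul ha
    have hP0 : P ≠ 0 := by rintro rfl; simp at h0
    have reduce : ∀ L Q : ℝ[X], P = L * Q → 0 < L.natDegree →
        (∀ x ∈ Set.Icc (-1 : ℝ) 1, 0 ≤ L.eval x) →
        L.natDegree ≤ n ∧ IsLukacs (n - L.natDegree) Q := by
      intro L Q hPQ hLdeg hL
      have hL0 : L ≠ 0 := by rintro rfl; simp at hLdeg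
      have hQ0 : Q ≠ 0 := by rintro rfl; simp [hPQ] at hP0
      have hd := natDegree_mul hL0 hQ0
      rw [← hPQ] at hd
      refine ⟨by omega, ih _ (by omega) Q (by omega) ?_⟩
      exact eval_nonneg_of_mul hL0 hL (hPQ ▸ hP)
    obtain ⟨z, hz⟩ := IsAlgClosed.exists_aeval_eq_zero ℂ P
      (fun h => h0 (natDegree_eq_of_degree_eq_some h))
    by_cases him : z.im = 0
    · have hroot : P.IsRoot z.re := by
        have hzre : z = (algebraMap ℝ ℂ) z.re := Complex.ext (by simp) (by simp [him])
        rw [hzre, aeval_algebraMap_apply] at hz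
        simpa using hz
      obtain ⟨Q, hQ⟩ := dvd_iff_isRoot.2 hroot
      rcases le_or_gt 1 z.re with h1 | h1
      · have hd : (C z.re - X : ℝ[X]).natDegree = 1 := by
          rw [← natDegree_neg, neg_sub, natDegree_X_sub_C]
        obtain ⟨h2, h3⟩ := reduce (C z.re - X) (-Q) (by rw [hQ]; ring) (by omega)
          (fun x hx => by simp only [eval_sub, eval_C, eval_X]; linarith [hx.2])
        have h4 := h3.sub_X_mul h1
        rw [hd, Nat.sub_add_cancel (hd ▸ h2)] at h4
        rwa [show (C z.re - X) * -Q = P by rw [hQ]; ring] at h4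
      rcases le_or_gt z.re (-1) with h2 | h2
      · obtain ⟨h3, h4⟩ := reduce (X - C z.re) Q hQ (by simp)
          (fun x hx => by simp only [eval_sub, eval_C, eval_X]; linarith [hx.1])
        have h5 := h4.X_add_mul (show 1 ≤ -z.re by linarith)
        rw [natDegree_X_sub_C] at h3 h5
        rw [Nat.sub_add_cancel h3] at h5
        rwa [show (C (-z.re) + X) * Q = P by rw [hQ, C_neg]; ring] at h5
      · have hQroot : Q.IsRoot z.re := by
          by_contra hne
          have hcont : ContinuousAt (fun x => Q.eval x) z.re := Q.continuous.continuousAt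
          have hsign : ∀ x ∈ Set.Icc (-1 : ℝ) 1, 0 ≤ (x - z.re) * Q.eval x := fun x hx => by
            simpa [hQ] using hP x hx
          rcases lt_or_gt_of_ne (show Q.eval z.re ≠ 0 from hne) with hneg | hpos
          · have h3 : ∀ᶠ x in nhdsWithin z.re (Set.Ioi z.re), Q.eval x < 0 :=
              (hcont.eventually_lt_const hneg).filter_mono nhdsWithin_le_nhds
            obtain ⟨x, hx, hx2⟩ := (h3.and (Ioo_mem_nhdsGT h1)).exists
            have := hsign x ⟨by linarith [hx2.1], hx2.2.le⟩
            nlinarith [hx2.1]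
          · have h3 : ∀ᶠ x in nhdsWithin z.re (Set.Iio z.re), 0 < Q.eval x :=
              (hcont.eventually_const_lt hpos).filter_mono nhdsWithin_le_nhds
            obtain ⟨x, hx, hx2⟩ := (h3.and (Ioo_mem_nhdsLT h2)).exists
            have := hsign x ⟨hx2.1.le, by linarith [hx2.2]⟩
            nlinarith [hx2.2]
        obtain ⟨R, hR⟩ := dvd_iff_isRoot.2 hQroot
        have hd : ((X - C z.re : ℝ[X]) ^ 2).natDegree = 2 := by
          rw [natDegree_pow, natDegree_X_sub_C]
        obtain ⟨h3, h4⟩ := reduce ((X - C z.re) ^ 2) R (by rw [hQ, hR]; ring) (by omega)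
          (fun x _ => by rw [eval_pow]; exact sq_nonneg _)
        have h5 := h4.mul_term (m := 2) 0 0 (X - C z.re) (by simp)
        rw [hd] at h3 h5
        rw [Nat.sub_add_cancel h3] at h5
        rwa [show (1 + X) ^ 0 * (1 - X) ^ 0 * (X - C z.re) ^ 2 * R = P by
          rw [hQ, hR]; ring] at h5
    · obtain ⟨Q, hQ⟩ := P.quadratic_dvd_of_aeval_eq_zero_im_ne_zero hz him
      have hsq : X ^ 2 - C (2 * z.re) * X + C (‖z‖ ^ 2) = (X - C z.re) ^ 2 + C (z.im ^ 2) := by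
        rw [← Complex.normSq_eq_norm_sq, Complex.normSq_apply]
        simp only [map_add, map_mul, map_pow, C_ofNat]
        ring
      have hd : ((X - C z.re : ℝ[X]) ^ 2 + C (z.im ^ 2)).natDegree = 2 := by
        rw [natDegree_add_C, natDegree_pow, natDegree_X_sub_C]
      rw [hsq] at hQ
      obtain ⟨h3, h4⟩ := reduce _ Q hQ (by omega) (fun x _ => by
        simp only [eval_add, eval_pow, eval_sub, eval_X, eval_C]; positivity)
      have h5 := (h4.mul_term (m := 2) 0 0 (X - C z.re) (by simp)).add
        ((h4.mono (Nat.le_add_right _ 2)).const_mul (sq_nonneg z.im))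
      rw [hd] at h3 h5
      rw [Nat.sub_add_cancel h3] at h5
      rwa [show (1 + X) ^ 0 * (1 - X) ^ 0 * (X - C z.re) ^ 2 * Q + C (z.im ^ 2) * Q = P by
        rw [hQ]; ring] at h5

lemma sum_sub_mul_quadratic (x A B C : ℝ) (n : ℕ) :
    ∑ l ∈ Finset.range (n + 1), (x - l) * (A * l ^ 2 + B * l + C) =
      x * (A * (n * (n + 1) * (2 * n + 1) / 6) + B * (n * (n + 1) / 2) + C * (n + 1)) -
        (A * (n * (n + 1) / 2) ^ 2 + B * (n * (n + 1) * (2 * n + 1) / 6) +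
          C * (n * (n + 1) / 2)) := by
  induction n with
  | zero => simp
  | succ n ih =>
    rw [Finset.sum_range_succ, ih]
    push_cast
    ring

lemma sum_abs_sub_mul_quadratic (A B C : ℝ) (k m : ℕ) :
    ∑ l ∈ Finset.range (k + m + 1), |(k : ℝ) - l| * (A * l ^ 2 + B * l + C) =
      2 * ∑ l ∈ Finset.range (k + 1), ((k : ℝ) - l) * (A * l ^ 2 + B * l + C) -
        ∑ l ∈ Finset.range (k + m + 1), ((k : ℝ) - l) * (A * l ^ 2 + B * l + C) := by
  induction m with
  | zero =>
    rw [add_zero, two_mul, add_sub_cancel_right]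
    refine Finset.sum_congr rfl fun l hl => ?_
    rw [abs_of_nonneg]
    have : l ≤ k := by simpa [Nat.lt_succ_iff] using hl
    exact sub_nonneg.2 (by exact_mod_cast this)
  | succ m ih =>
    rw [← add_assoc, Finset.sum_range_succ, ih, Finset.sum_range_succ _ (k + m + 1), abs_of_nonpos]
    · ring
    · push_cast
      have : (0 : ℝ) ≤ m := by positivity
      linarith

/-- A symmetric Schur test. -/
lemma sum_sum_mul_le_of_row_sums {A : Finset ℕ} {K : ℕ → ℕ → ℝ} {w μ : ℕ → ℝ}
    (hK : ∀ k l, 0 ≤ K k l) (hsymm : ∀ k l, K k l = K l k) (hw : ∀ k ∈ A, 0 < w k)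
    (hrow : ∀ k ∈ A, ∑ l ∈ A, K k l * w l ≤ μ k * w k) (x : ℕ → ℝ) :
    ∑ k ∈ A, ∑ l ∈ A, K k l * (x k * x l) ≤ ∑ k ∈ A, μ k * x k ^ 2 := by
  have hle : ∀ k ∈ A, ∀ l ∈ A, K k l * (x k * x l) ≤
      (K k l * w l / w k * x k ^ 2 + K l k * w k / w l * x l ^ 2) / 2 := fun k hk l hl => by
    have h1 := hw k hk
    have h2 := hw l hl
    have h3 : K k l * w l / w k * x k ^ 2 + K l k * w k / w l * x l ^ 2 - 2 * (K k l * (x k * x l))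
        = K k l * (w l * x k - w k * x l) ^ 2 / (w k * w l) := by
      rw [hsymm l k]
      field_simp
      ring
    have h4 : 0 ≤ K k l * (w l * x k - w k * x l) ^ 2 / (w k * w l) :=
      div_nonneg (mul_nonneg (hK k l) (sq_nonneg _)) (mul_pos h1 h2).le
    linarith
  have hswap : ∑ k ∈ A, ∑ l ∈ A, K l k * w k / w l * x l ^ 2 =
      ∑ k ∈ A, ∑ l ∈ A, K k l * w l / w k * x k ^ 2 := Finset.sum_comm
  calc _ ≤ ∑ k ∈ A, ∑ l ∈ A,
        (K k l * w l / w k * x k ^ 2 + K l k * w k / w l * x l ^ 2) / 2 :=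
        Finset.sum_le_sum fun k hk => Finset.sum_le_sum fun l hl => hle k hk l hl
    _ = ∑ k ∈ A, ∑ l ∈ A, K k l * w l / w k * x k ^ 2 := by
        simp only [← Finset.sum_div, Finset.sum_add_distrib]
        rw [hswap]
        ring
    _ ≤ _ := Finset.sum_le_sum fun k hk => by
        rw [← Finset.sum_mul, ← Finset.sum_div]
        exact mul_le_mul_of_nonneg_right ((div_le_iff₀ (hw k hk)).2 (hrow k hk)) (sq_nonneg _)

lemma sum_sum_abs_sub_mul_le {r : ℕ} (hr : 2 ≤ r) (x : ℕ → ℝ) :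
    ∑ k ∈ Finset.range (r + 1), ∑ l ∈ Finset.range (r + 1), |(k : ℝ) - l| * (x k * x l) ≤
      (2 * r ^ 2 + 2 * r + 1) / 5 * (x 0 ^ 2 + ∑ k ∈ Finset.range (r + 1), x k ^ 2) := by
  set W : ℕ → ℝ := fun l => 10 * l ^ 2 + -10 * r * l + (6 * r ^ 2 + 5 * r) with hW
  set w : ℕ → ℝ := fun l => W l - if l = 0 then (2 / 5) * (6 * r ^ 2 + 5 * r : ℝ) else 0 with hw
  set μ : ℕ → ℝ := fun l => (2 * r ^ 2 + 2 * r + 1) / 5 * if l = 0 then 2 else 1 with hμ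
  have hr' : (2 : ℝ) ≤ r := by exact_mod_cast hr
  have hrow : ∀ k ∈ Finset.range (r + 1),
      ∑ l ∈ Finset.range (r + 1), |(k : ℝ) - l| * w l ≤ μ k * w k := fun k hk => by
    obtain ⟨m, rfl⟩ := Nat.exists_eq_add_of_le (Nat.lt_succ_iff.1 (Finset.mem_range.1 hk))
    have h1 : ∑ l ∈ Finset.range (k + m + 1), |(k : ℝ) - l| * w l =
        ∑ l ∈ Finset.range (k + m + 1), |(k : ℝ) - l| * W l -
          k * ((2 / 5) * (6 * (k + m : ℕ) ^ 2 + 5 * (k + m : ℕ))) := by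
      simp [hw, mul_sub, Finset.sum_sub_distrib]
    rw [h1, hW, sum_abs_sub_mul_quadratic, sum_sub_mul_quadratic, sum_sub_mul_quadratic,
      ← sub_nonneg]
    cases k with
    | zero =>
      obtain ⟨j, rfl⟩ := Nat.exists_eq_add_of_le (show 2 ≤ m by omega)
      simp only [hw, hW, hμ, if_true]
      push_cast
      ring_nf
      positivity
    | succ k =>
      simp only [hw, hW, hμ, Nat.succ_ne_zero, if_false]
      push_cast
      ring_nf
      positivity
  have hpos : ∀ k ∈ Finset.range (r + 1), 0 < w k := fun k _ => by
    simp only [hw, hW]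
    split_ifs with h
    · rw [h]
      push_cast
      nlinarith
    · nlinarith [sq_nonneg (2 * (k : ℝ) - r)]
  refine (sum_sum_mul_le_of_row_sums (fun k l => abs_nonneg _) (fun k l => abs_sub_comm _ _)
    hpos hrow x).trans_eq ?_
  have h2 : ∀ k, μ k * x k ^ 2 = (2 * r ^ 2 + 2 * r + 1) / 5 * (if k = 0 then x 0 ^ 2 else 0) +
      (2 * r ^ 2 + 2 * r + 1) / 5 * x k ^ 2 := fun k => by
    simp only [hμ]
    split_ifs with h
    · rw [h]; ring
    · ring
  simp only [h2, Finset.sum_add_distrib, ← Finset.mul_sum]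
  simp [mul_add]

lemma sum_sum_mul_min (r : ℕ) :
    ∑ k ∈ Finset.range r, ∑ l ∈ Finset.range r,
        ((k : ℝ) + 1) * (l + 1) * (min (k : ℝ) l + 1) =
      (r : ℝ) * (r + 1) * (2 * r + 1) * (2 * r ^ 2 + 2 * r + 1) / 30 := by
  have hsq : ∀ r : ℕ, ∑ k ∈ Finset.range r, ((k : ℝ) + 1) ^ 2 =
      (r : ℝ) * (r + 1) * (2 * r + 1) / 6 :=
    fun r => by
      induction r with
      | zero => simp
      | succ r ih => rw [Finset.sum_range_succ, ih]; push_cast; ring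
  induction r with
  | zero => simp
  | succ r ih =>
    have hmin : ∀ k ∈ Finset.range r, min (k : ℝ) r = k := fun k hk =>
      min_eq_left (by exact_mod_cast (Finset.mem_range.1 hk).le)
    have h1 : ∑ k ∈ Finset.range r, ((k : ℝ) + 1) * (r + 1) * (min (k : ℝ) r + 1) =
        (r + 1) * ∑ k ∈ Finset.range r, ((k : ℝ) + 1) ^ 2 := by
      rw [Finset.mul_sum]
      exact Finset.sum_congr rfl fun k hk => by rw [hmin k hk]; ring
    have h2 : ∑ k ∈ Finset.range r, ((r : ℝ) + 1) * (k + 1) * (min (r : ℝ) k + 1) =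
        (r + 1) * ∑ k ∈ Finset.range r, ((k : ℝ) + 1) ^ 2 := by
      rw [← h1]
      exact Finset.sum_congr rfl fun k _ => by rw [min_comm]; ring
    rw [Finset.sum_range_succ]
    simp only [Finset.sum_range_succ _ r]
    rw [Finset.sum_add_distrib, ih, h1, h2, hsq, min_self]
    push_cast
    ring

lemma BoundsSum.le_of_odd {m : ℕ} {M : ℝ} (hM : BoundsSum (2 * m + 1) M) :
    (2 * (m + 1) ^ 2 + 2 * (m + 1) + 1) / 5 ≤ M := by
  set p : ℝ[X] := ∑ k ∈ Finset.range (m + 1), (k + 1 : ℝ) • u k with hp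
  have expand : ∀ L : ℝ[X] →ₗ[ℝ] ℝ, L (p ^ 2) = ∑ k ∈ Finset.range (m + 1),
      ∑ l ∈ Finset.range (m + 1), ((k : ℝ) + 1) * (l + 1) * L (u k * u l) := fun L => by
    rw [sq, hp, Finset.sum_mul_sum, map_sum]
    refine Finset.sum_congr rfl fun k _ => ?_
    rw [map_sum]
    exact Finset.sum_congr rfl fun l _ => by
      rw [smul_mul_smul_comm, map_smul, smul_eq_mul]
  have hdeg : p.natDegree ≤ m := by
    refine natDegree_sum_le_of_forall_le _ _ fun k hk => (natDegree_smul_le _ _).trans ?_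
    rw [natDegree_eq_of_degree_eq_some (degree_u k)]
    have := Finset.mem_range.1 hk
    omega
  have h2 : (p ^ 2).natDegree ≤ 2 * p.natDegree := natDegree_pow_le
  have h := hM (p ^ 2) (by omega) fun x _ => by rw [eval_pow]; exact sq_nonneg _
  have h3 : ∑ n ∈ Finset.range (2 * m + 1), uCoeff n (p ^ 2) =
      ∑ k ∈ Finset.range (m + 1), ∑ l ∈ Finset.range (m + 1),
        ((k : ℝ) + 1) * (l + 1) * (min (k : ℝ) l + 1) := by
    have h4 := expand (∑ n ∈ Finset.range (2 * m + 1), uCoeff n)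
    rw [LinearMap.sum_apply] at h4
    rw [h4]
    refine Finset.sum_congr rfl fun k hk => Finset.sum_congr rfl fun l hl => ?_
    rw [Finset.mem_range] at hk hl
    rw [LinearMap.sum_apply, sum_uCoeff_u_mul_u (by omega), Nat.cast_min]
  have h5 : uCoeff 0 (p ^ 2) = (m + 1) * (m + 2) * (2 * m + 3) / 6 := by
    rw [expand]
    simp only [uCoeff_zero_u_mul_u, mul_ite, mul_one, mul_zero, Finset.sum_ite_eq]
    rw [Finset.sum_congr rfl fun k hk => if_pos hk]
    clear * -
    induction m with
    | zero => norm_num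
    | succ m ih => rw [Finset.sum_range_succ, ih]; push_cast; ring
  rw [h3, sum_sum_mul_min, h5] at h
  push_cast at h
  have h6 : (0 : ℝ) < (m + 1) * (m + 2) * (2 * m + 3) / 6 := by positivity
  refine le_of_mul_le_mul_right (le_trans (le_of_eq ?_) h) h6
  ring

/-- A polynomial `v a` with `(1 - X ^ 2) * v a = t (a % 2) - t a`. -/
noncomputable def v : ℕ → ℝ[X]
  | 0 => 0
  | 1 => 0
  | a + 2 => v a + 2 * u a

lemma one_sub_X_sq_mul_v (a : ℕ) : (1 - X ^ 2) * v a = t (a % 2) - t a := by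
  induction a using Nat.twoStepInduction with
  | zero => simp [v]
  | one => simp [v]
  | more a ih _ =>
    rw [v, mul_add, ih, Nat.add_mod_right]
    linear_combination one_sub_X_sq_mul_u a

lemma absSum_v_sub_v_le (N a i : ℕ) : absSum N (v (a + 2 * i) - v a) ≤ 2 * i := by
  induction i with
  | zero => simp [absSum]
  | succ i ih =>
    have h := absSum_add_le N (v (a + 2 * i) - v a) ((2 : ℝ) • u (a + 2 * i))
    rw [absSum_smul, abs_two] at h
    have h1 := absSum_u_le N (a + 2 * i)
    rw [show v (a + 2 * (i + 1)) - v a = v (a + 2 * i) - v a + (2 : ℝ) • u (a + 2 * i) by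
      rw [show a + 2 * (i + 1) = a + 2 * i + 2 by ring, v, smul_eq_C_mul, C_ofNat]; ring]
    push_cast
    linarith

lemma uCoeff_zero_v (a : ℕ) :
    uCoeff 0 (v a) = (if a % 2 = 0 then 2 else 0) - if a = 0 then 2 else 0 := by
  induction a using Nat.twoStepInduction with
  | zero => simp [v]
  | one => simp [v]
  | more a ih _ =>
    rw [v, map_add, ih, show 2 * u a = (2 : ℝ) • u a by rw [smul_eq_C_mul, C_ofNat], map_smul,
      uCoeff_u, Nat.add_mod_right]
    simp only [eq_comm (a := 0) (b := a), smul_eq_mul]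
    split_ifs <;> simp_all

lemma sum_smul_mod_two_eq_zero {E : Type*} [AddCommGroup E] [Module ℝ E] {A : Finset ℕ} {c : ℕ → ℝ}
    (h0 : ∑ l ∈ A, c l = 0) (h1 : ∑ l ∈ A, c l * (-1) ^ l = 0) (g : ℕ → E) :
    ∑ l ∈ A, c l • g (l % 2) = 0 := by
  have hl : ∀ l, c l • g (l % 2) = c l • ((1 / 2 : ℝ) • (g 0 + g 1)) +
      (c l * (-1) ^ l) • ((1 / 2 : ℝ) • (g 0 - g 1)) := fun l => by
    rcases Nat.even_or_odd l with h | h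
    · rw [h.neg_one_pow, Nat.even_iff.1 h]; module
    · rw [h.neg_one_pow, Nat.odd_iff.1 h]; module
  simp only [hl, Finset.sum_add_distrib, ← Finset.sum_smul, h0, h1, zero_smul, add_zero]

lemma sum_sum_smul_mod_two_eq_zero {E : Type*} [AddCommGroup E] [Module ℝ E] {A : Finset ℕ}
    {c : ℕ → ℝ} (h0 : ∑ l ∈ A, c l = 0) (h1 : ∑ l ∈ A, c l * (-1) ^ l = 0) (g : ℕ → ℕ → E) :
    ∑ k ∈ A, ∑ l ∈ A, (c k * c l) • g k ((k + l) % 2) = 0 := by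
  refine Finset.sum_eq_zero fun k _ => ?_
  have h := sum_smul_mod_two_eq_zero h0 h1 fun e => g k ((k + e) % 2)
  simp only [Nat.add_mod_mod] at h
  simp only [mul_smul, ← Finset.smul_sum, h, smul_zero]

/-- The coefficients in the expansion of `(1 - X ^ 2) * q ^ 2` obtained from that of
`(1 - X ^ 2) * q` along the sequence `t`. -/
noncomputable def pairCoeff (k l : ℕ) : ℝ[X] :=
  v (k + l) + v ((k - l) + (l - k)) - ((1 / 2 : ℝ) • v (2 * k + (k + l) % 2) +
    (1 / 2 : ℝ) • v (2 * l + (k + l) % 2))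

lemma pairCoeff_comm (k l : ℕ) : pairCoeff k l = pairCoeff l k := by
  rw [pairCoeff, pairCoeff, add_comm k l, add_comm (k - l), add_comm ((1 / 2 : ℝ) • _)]

lemma absSum_pairCoeff_le (N k l : ℕ) : absSum N (pairCoeff k l) ≤ 2 * |(k : ℝ) - l| := by
  wlog h : k ≤ l generalizing k l
  · rw [pairCoeff_comm, abs_sub_comm]
    exact this l k (by omega)
  obtain ⟨i, e, he, rfl⟩ : ∃ i e, e < 2 ∧ l = k + (2 * i + e) :=
    ⟨(l - k) / 2, (l - k) % 2, Nat.mod_lt _ two_pos, by omega⟩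
  have hv : v e = 0 := by interval_cases e <;> rfl
  have h1 := absSum_v_sub_v_le N e i
  have h2 := absSum_v_sub_v_le N (2 * k + e) i
  have h3 := absSum_v_sub_v_le N (2 * k + e + 2 * i) (i + e)
  have hd : pairCoeff k (k + (2 * i + e)) = (v (e + 2 * i) - v e) +
      (1 / 2 : ℝ) • (v (2 * k + e + 2 * i) - v (2 * k + e)) -
      (1 / 2 : ℝ) • (v (2 * k + e + 2 * i + 2 * (i + e)) - v (2 * k + e + 2 * i)) := by
    rw [pairCoeff, hv, show (k + (k + (2 * i + e))) % 2 = e by omega,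
      show k + (k + (2 * i + e)) = 2 * k + e + 2 * i by ring,
      show k - (k + (2 * i + e)) + (k + (2 * i + e) - k) = e + 2 * i by omega,
      show 2 * (k + (2 * i + e)) + e = 2 * k + e + 2 * i + 2 * (i + e) by ring]
    module
  rw [hd, show |(k : ℝ) - (k + (2 * i + e) : ℕ)| = 2 * i + e by
    rw [abs_of_nonpos] <;> push_cast <;> linarith [(Nat.cast_nonneg i : (0 : ℝ) ≤ i),
      (Nat.cast_nonneg e : (0 : ℝ) ≤ e)]]
  refine (absSum_sub_le _ _ _).trans ?_
  have h4 := absSum_add_le N (v (e + 2 * i) - v e)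
    ((1 / 2 : ℝ) • (v (2 * k + e + 2 * i) - v (2 * k + e)))
  rw [absSum_smul, abs_of_pos one_half_pos] at h4 ⊢
  push_cast at h3
  have := (Nat.cast_nonneg e : (0 : ℝ) ≤ e)
  linarith

lemma absSum_one_sub_X_sq_mul_sq_le {m : ℕ} {M : ℝ} (hM : BoundsSum (2 * m + 1) M) {q : ℝ[X]}
    (hq : 2 + 2 * q.natDegree < 2 * m + 1) :
    absSum (2 * m + 1) ((1 - X ^ 2) * q ^ 2) ≤ M * uCoeff 0 ((1 - X ^ 2) * q ^ 2) := by
  have hdeg : ((1 - X ^ 2) * q).natDegree < m + 2 := by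
    have h1 : ((1 - X ^ 2) * q).natDegree ≤ (1 - X ^ 2 : ℝ[X]).natDegree + q.natDegree :=
      natDegree_mul_le
    have h2 : (1 - X ^ 2 : ℝ[X]).natDegree ≤ 2 := by compute_degree
    omega
  obtain ⟨h, hh⟩ := exists_eq_sum_smul tSequence (mem_degreeLT_of_natDegree_lt hdeg)
  change _ = ∑ k ∈ Finset.range (m + 2), h k • t k at hh
  set A := Finset.range (m + 2) with hA
  have h0 : ∑ l ∈ A, h l = 0 := by
    have := congrArg (eval 1) hh
    simpa [eval_finsetSum, t, eq_comm] using this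
  have h1 : ∑ l ∈ A, h l * (-1) ^ l = 0 := by
    have := congrArg (eval (-1)) hh
    simpa [eval_finsetSum, t, eq_comm] using this
  have hne : (1 - X ^ 2 : ℝ[X]) ≠ 0 := fun hX => by simpa using congrArg (eval 0) hX
  have hdist : ∀ k l, (1 - X ^ 2) * (v (k + l) + v ((k - l) + (l - k))) =
      (2 : ℝ) • t ((k + l) % 2) - (2 : ℝ) • (t k * t l) := fun k l => by
    wlog hkl : k ≤ l generalizing k l
    · have := this l k (by omega)
      rwa [add_comm l k, add_comm (l - k), mul_comm (t l)] at this
    obtain ⟨d, rfl⟩ := Nat.exists_eq_add_of_le hkl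
    have h2 := two_mul_t_mul_t k d
    rw [mul_add, one_sub_X_sq_mul_v, one_sub_X_sq_mul_v,
      show k - (k + d) + (k + d - k) = d by omega,
      show (k + (k + d)) % 2 = d % 2 by omega, show k + (k + d) = 2 * k + d by ring]
    simp only [smul_eq_C_mul, C_ofNat]
    linear_combination h2
  have hP1 : (1 - X ^ 2) * q ^ 2 = (-1 / 2 : ℝ) •
      ∑ k ∈ A, ∑ l ∈ A, (h k * h l) • (v (k + l) + v ((k - l) + (l - k))) := by
    refine mul_left_cancel₀ hne ?_
    have h2 : (1 - X ^ 2) * ((1 - X ^ 2) * q ^ 2) =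
        ∑ k ∈ A, ∑ l ∈ A, (h k * h l) • (t k * t l) := by
      rw [show (1 - X ^ 2) * ((1 - X ^ 2) * q ^ 2) = ((1 - X ^ 2) * q) ^ 2 by ring, hh, sq,
        Finset.sum_mul_sum]
      simp only [smul_mul_smul_comm]
    rw [mul_smul_comm, h2]
    simp only [Finset.mul_sum, mul_smul_comm, hdist, smul_sub, Finset.sum_sub_distrib]
    rw [sum_sum_smul_mod_two_eq_zero h0 h1 fun _ e => (2 : ℝ) • t e]
    simp only [smul_comm _ (2 : ℝ), ← Finset.smul_sum]
    module
  have hP2 : (1 - X ^ 2) * q ^ 2 =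
      (-1 / 2 : ℝ) • ∑ k ∈ A, ∑ l ∈ A, (h k * h l) • pairCoeff k l := by
    have h2 := sum_sum_smul_mod_two_eq_zero h0 h1 fun k e => (1 / 2 : ℝ) • v (2 * k + e)
    have h3 : ∑ k ∈ A, ∑ l ∈ A, (h k * h l) • (1 / 2 : ℝ) • v (2 * l + (k + l) % 2) = 0 := by
      rw [Finset.sum_comm, ← h2]
      exact Finset.sum_congr rfl fun k _ => Finset.sum_congr rfl fun l _ => by
        rw [mul_comm (h l), add_comm l k]
    rw [hP1]
    simp only [pairCoeff, smul_sub, smul_add, Finset.sum_sub_distrib, Finset.sum_add_distrib, h2,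
      h3]
    simp
  have hzero : uCoeff 0 ((1 - X ^ 2) * q ^ 2) = h 0 ^ 2 + ∑ k ∈ A, h k ^ 2 := by
    have h2 := sum_sum_smul_mod_two_eq_zero h0 h1 fun _ e => if e = 0 then (4 : ℝ) else 0
    have h3 : ∀ k l, uCoeff 0 (v (k + l) + v ((k - l) + (l - k))) =
        (if (k + l) % 2 = 0 then 4 else 0) -
          ((if k = 0 then if l = 0 then 2 else 0 else 0) + if k = l then 2 else 0) := fun k l => by
      rw [map_add, uCoeff_zero_v, uCoeff_zero_v,
        show ((k - l) + (l - k)) % 2 = (k + l) % 2 by omega]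
      simp only [show (k - l) + (l - k) = 0 ↔ k = l by omega, Nat.add_eq_zero_iff, ite_and]
      split_ifs <;> ring
    rw [hP1, map_smul]
    simp only [map_sum, map_smul, h3, smul_eq_mul, mul_sub, Finset.sum_sub_distrib] at h2 ⊢
    rw [h2]
    have h4 : ∑ k ∈ A, ∑ l ∈ A, h k * h l * (if k = l then (2 : ℝ) else 0) =
        2 * ∑ k ∈ A, h k ^ 2 := by
      rw [Finset.mul_sum]
      refine Finset.sum_congr rfl fun k hk => ?_
      simp only [mul_ite, mul_zero, Finset.sum_ite_eq, if_pos hk]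
      ring
    simp only [mul_add, Finset.sum_add_distrib, h4]
    simp [hA]
    ring
  have hbound : absSum (2 * m + 1) ((1 - X ^ 2) * q ^ 2) ≤
      ∑ k ∈ A, ∑ l ∈ A, |(k : ℝ) - l| * (|h k| * |h l|) := by
    rw [hP2, absSum_smul]
    refine (mul_le_mul_of_nonneg_left (absSum_sum_le _ _ _) (abs_nonneg _)).trans ?_
    rw [Finset.mul_sum]
    refine Finset.sum_le_sum fun k _ => ?_
    refine (mul_le_mul_of_nonneg_left (absSum_sum_le _ _ _) (abs_nonneg _)).trans ?_
    rw [Finset.mul_sum]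
    refine Finset.sum_le_sum fun l _ => ?_
    rw [absSum_smul, abs_mul, show |(-1 / 2 : ℝ)| = 1 / 2 by norm_num [abs_of_neg]]
    have := mul_le_mul_of_nonneg_left (absSum_pairCoeff_le (2 * m + 1) k l)
      (mul_nonneg (abs_nonneg (h k)) (abs_nonneg (h l)))
    linarith
  have hschur := sum_sum_abs_sub_mul_le (show 2 ≤ m + 1 by omega) fun k => |h k|
  simp only [sq_abs] at hschur
  rw [← hA, ← hzero] at hschur
  refine hbound.trans (hschur.trans (mul_le_mul_of_nonneg_right ?_ ?_))
  · push_cast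
    exact hM.le_of_odd
  · rw [hzero]
    positivity

lemma exists_reduce_weight (i j : ℕ) (p : ℝ[X]) :
    ∃ e f : ℕ, ∃ q : ℝ[X], e < 2 ∧ f < 2 ∧ e + f + 2 * q.natDegree ≤ i + j + 2 * p.natDegree ∧
      (1 + X) ^ i * (1 - X) ^ j * p ^ 2 = (1 + X) ^ e * (1 - X) ^ f * q ^ 2 := by
  refine ⟨i % 2, j % 2, (1 + X) ^ (i / 2) * (1 - X) ^ (j / 2) * p, Nat.mod_lt _ two_pos,
    Nat.mod_lt _ two_pos, ?_, ?_⟩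
  · have h : ((1 + X) ^ (i / 2) * (1 - X) ^ (j / 2) * p).natDegree ≤
        i / 2 * 1 + j / 2 * 1 + p.natDegree := by
      refine natDegree_mul_le_of_le (natDegree_mul_le_of_le ?_ ?_) le_rfl <;>
        exact natDegree_pow_le_of_le _ (by compute_degree)
    omega
  · conv_lhs => rw [← Nat.div_add_mod i 2, ← Nat.div_add_mod j 2]
    ring

lemma natDegree_one_add_X_mul_le (p : ℝ[X]) : ((1 + X) * p).natDegree ≤ 1 + p.natDegree :=
  natDegree_mul_le_of_le (by compute_degree) le_rfl

lemma natDegree_one_sub_X_mul_le (p : ℝ[X]) : ((1 - X) * p).natDegree ≤ 1 + p.natDegree :=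
  natDegree_mul_le_of_le (by compute_degree) le_rfl

lemma of_add_eq_two_mul {Q : ℝ[X] → Prop} (hadd : ∀ A B, Q A → Q B → Q (A + B))
    (hhalf : ∀ A, Q A → Q ((1 / 2 : ℝ) • A)) {A B C : ℝ[X]} (h : A + B = 2 * C) (hA : Q A)
    (hB : Q B) : Q C := by
  have h1 := hhalf _ (hadd _ _ hA hB)
  rw [h, show 2 * C = (2 : ℝ) • C by rw [smul_eq_C_mul, C_ofNat], smul_smul] at h1
  simpa using h1

/-- Sums of Lukács terms of odd formal degree reduce to the weights `1 + X` and `1 - X`. -/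
lemma IsLukacs.induction_odd {m : ℕ} {P : ℝ[X]} (hP : IsLukacs (2 * m + 1) P) {Q : ℝ[X] → Prop}
    (hadd : ∀ A B, Q A → Q B → Q (A + B)) (hhalf : ∀ A, Q A → Q ((1 / 2 : ℝ) • A))
    (h1 : ∀ p : ℝ[X], p.natDegree ≤ m → Q ((1 + X) * p ^ 2))
    (h2 : ∀ p : ℝ[X], p.natDegree ≤ m → Q ((1 - X) * p ^ 2)) : Q P := by
  induction hP with
  | add _ _ ih1 ih2 => exact hadd _ _ ih1 ih2
  | term i j p h =>
    obtain ⟨e, f, q, he, hf, hd, hq⟩ := exists_reduce_weight i j p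
    rw [hq]
    have h3 := natDegree_one_add_X_mul_le q
    have h4 := natDegree_one_sub_X_mul_le q
    interval_cases e <;> interval_cases f
    · exact of_add_eq_two_mul hadd hhalf (by ring) (h1 q (by omega)) (h2 q (by omega))
    · simpa using h2 q (by omega)
    · simpa using h1 q (by omega)
    · exact of_add_eq_two_mul hadd hhalf (by ring) (h2 ((1 + X) * q) (by omega))
        (h1 ((1 - X) * q) (by omega))

/-- Sums of Lukács terms of even formal degree reduce to the weights `1` and `1 - X ^ 2`. -/
lemma IsLukacs.induction_even {m : ℕ} {P : ℝ[X]} (hP : IsLukacs (2 * m) P) {Q : ℝ[X] → Prop}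
    (hadd : ∀ A B, Q A → Q B → Q (A + B)) (hhalf : ∀ A, Q A → Q ((1 / 2 : ℝ) • A))
    (h1 : ∀ p : ℝ[X], p.natDegree ≤ m → Q (p ^ 2))
    (h2 : ∀ p : ℝ[X], 1 + p.natDegree ≤ m → Q ((1 - X ^ 2) * p ^ 2)) : Q P := by
  induction hP with
  | add _ _ ih1 ih2 => exact hadd _ _ ih1 ih2
  | term i j p h =>
    obtain ⟨e, f, q, he, hf, hd, hq⟩ := exists_reduce_weight i j p
    rw [hq]
    have h3 := natDegree_one_add_X_mul_le q
    have h4 := natDegree_one_sub_X_mul_le q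
    interval_cases e <;> interval_cases f
    · simpa using h1 q (by omega)
    · exact of_add_eq_two_mul hadd hhalf (by ring) (h1 ((1 - X) * q) (by omega)) (h2 q (by omega))
    · exact of_add_eq_two_mul hadd hhalf (by ring) (h1 ((1 + X) * q) (by omega)) (h2 q (by omega))
    · have h5 := h2 q (by omega)
      rwa [show (1 - X ^ 2) * q ^ 2 = (1 + X) ^ 1 * (1 - X) ^ 1 * q ^ 2 by ring] at h5

lemma uCoeff_zero_one_add_X_mul_sq_nonneg (p : ℝ[X]) : 0 ≤ uCoeff 0 ((1 + X) * p ^ 2) := by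
  obtain ⟨a, ha⟩ := exists_eq_sum_smul sSequence
    (mem_degreeLT_of_natDegree_lt p.natDegree.lt_succ_self)
  change _ = ∑ k ∈ _, a k • s k at ha
  rw [ha, sq, Finset.sum_mul_sum, Finset.mul_sum, map_sum]
  refine Finset.sum_nonneg fun k _ => ?_
  rw [Finset.mul_sum, map_sum]
  refine Finset.sum_nonneg fun l _ => ?_
  rw [smul_mul_smul_comm, mul_smul_comm, ← mul_assoc, map_smul, smul_eq_mul]
  rcases eq_or_ne k l with rfl | hkl
  · exact mul_nonneg (mul_self_nonneg _) (uCoeff_weighted_s_nonneg 0 k k)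
  · rw [uCoeff_zero_weighted_s hkl, mul_zero]

lemma uCoeff_zero_nonneg {P : ℝ[X]} (hP : ∀ x ∈ Set.Icc (-1 : ℝ) 1, 0 ≤ P.eval x) :
    0 ≤ uCoeff 0 P := by
  refine (isLukacs_of_nonneg (2 * P.natDegree + 1) P (by omega) hP).induction_odd
    (Q := fun P => 0 ≤ uCoeff 0 P) (fun A B hA hB => ?_) (fun A hA => ?_) (fun p _ => ?_)
    (fun p _ => ?_)
  · rw [map_add]; exact add_nonneg hA hB
  · rw [map_smul, smul_eq_mul]; positivity
  · exact uCoeff_zero_one_add_X_mul_sq_nonneg p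
  · have h := uCoeff_zero_one_add_X_mul_sq_nonneg (p.comp (-X))
    rwa [show (1 + X) * (p.comp (-X)) ^ 2 = ((1 - X) * p ^ 2).comp (-X) by simp,
      uCoeff_comp_neg_X, pow_zero, one_mul] at h

lemma uCoeff_eq_uCoeff_zero_mul_u (n : ℕ) (P : ℝ[X]) : uCoeff n P = uCoeff 0 (P * u n) := by
  obtain ⟨a, ha⟩ := exists_eq_sum_smul uSequence
    (mem_degreeLT_of_natDegree_lt P.natDegree.lt_succ_self)
  change _ = ∑ k ∈ _, a k • u k at ha
  rw [ha, Finset.sum_mul, map_sum, map_sum]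
  refine Finset.sum_congr rfl fun k _ => ?_
  rw [smul_mul_assoc, map_smul, map_smul, uCoeff_zero_u_mul_u, uCoeff_u]
  simp only [eq_comm]

lemma abs_eval_u_le (n : ℕ) {x : ℝ} (hx : x ∈ Set.Icc (-1 : ℝ) 1) : |(u n).eval x| ≤ n + 1 := by
  induction n using Nat.twoStepInduction with
  | zero => simp
  | one =>
    rw [u_one, eval_mul, eval_ofNat, eval_X, abs_mul, abs_two]
    have := abs_le.2 hx
    push_cast
    linarith
  | more n ih _ =>
    have h1 : u (n + 2) = u n + 2 * t (n + 2) := by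
      simp only [u, t]
      push_cast
      rw [Chebyshev.U_eq_two_mul_T_add_U, add_comm]
    have h2 : |(t (n + 2)).eval x| ≤ 1 := Chebyshev.abs_eval_T_real_le_one _ (abs_le.2 hx)
    rw [h1, eval_add, eval_mul, eval_ofNat]
    refine (abs_add_le _ _).trans ?_
    rw [abs_mul, abs_two]
    push_cast
    linarith

lemma abs_uCoeff_le {P : ℝ[X]} (hP : ∀ x ∈ Set.Icc (-1 : ℝ) 1, 0 ≤ P.eval x) (n : ℕ) :
    |uCoeff n P| ≤ (n + 1) * uCoeff 0 P := by
  have h1 : 0 ≤ uCoeff 0 (P * (C (n + 1 : ℝ) - u n)) := uCoeff_zero_nonneg fun x hx => by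
    have := abs_le.1 (abs_eval_u_le n hx)
    rw [eval_mul, eval_sub, eval_C]
    exact mul_nonneg (hP x hx) (by linarith)
  have h2 : 0 ≤ uCoeff 0 (P * (C (n + 1 : ℝ) + u n)) := uCoeff_zero_nonneg fun x hx => by
    have := abs_le.1 (abs_eval_u_le n hx)
    rw [eval_mul, eval_add, eval_C]
    exact mul_nonneg (hP x hx) (by linarith)
  have h3 : uCoeff 0 (P * C (n + 1 : ℝ)) = (n + 1) * uCoeff 0 P := by
    rw [mul_comm, ← smul_eq_C_mul, map_smul, smul_eq_mul]
  rw [mul_sub, map_sub, h3, ← uCoeff_eq_uCoeff_zero_mul_u] at h1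
  rw [mul_add, map_add, h3, ← uCoeff_eq_uCoeff_zero_mul_u] at h2
  rw [abs_le]
  constructor <;> linarith

/-- The bound on the coefficient sum passes to the sum of absolute values. -/
lemma BoundsSum.absSum_le {N : ℕ} {M : ℝ} (hN : 0 < N) (hM : BoundsSum N M) {P : ℝ[X]}
    (hdeg : P.natDegree < N) (hP : ∀ x ∈ Set.Icc (-1 : ℝ) 1, 0 ≤ P.eval x) :
    absSum N P ≤ M * uCoeff 0 P := by
  have hL := isLukacs_of_nonneg (N - 1) P (by omega) hP
  have hadd : ∀ A B, absSum N A ≤ M * uCoeff 0 A → absSum N B ≤ M * uCoeff 0 B →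
      absSum N (A + B) ≤ M * uCoeff 0 (A + B) := fun A B hA hB => by
    rw [map_add, mul_add]
    exact (absSum_add_le _ _ _).trans (add_le_add hA hB)
  have hhalf : ∀ A, absSum N A ≤ M * uCoeff 0 A →
      absSum N ((1 / 2 : ℝ) • A) ≤ M * uCoeff 0 ((1 / 2 : ℝ) • A) := fun A hA => by
    rw [absSum_smul, map_smul, smul_eq_mul, abs_of_pos one_half_pos]
    linarith
  obtain ⟨m, rfl | rfl⟩ : ∃ m, N = 2 * m + 1 ∨ N = 2 * m + 1 + 1 := ⟨(N - 1) / 2, by omega⟩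
  · refine IsLukacs.induction_even hL (Q := fun P => absSum _ P ≤ M * uCoeff 0 P) hadd hhalf
      (fun p hp => ?_) fun p hp => ?_
    · exact absSum_sq_le hM (by omega)
    · exact absSum_one_sub_X_sq_mul_sq_le hM (by omega)
  · refine IsLukacs.induction_odd hL (Q := fun P => absSum _ P ≤ M * uCoeff 0 P) hadd hhalf
      (fun p hp => ?_) fun p hp => ?_
    · exact absSum_one_add_X_mul_sq_le hM (by omega)
    · exact absSum_one_sub_X_mul_sq_le hM (by omega)

/-- The polynomial with prescribed coefficients along the sequence `u`. -/
noncomputable def ofCoeff {N : ℕ} (α : Fin N → ℝ) : ℝ[X] := ∑ j : Fin N, α j • u j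

lemma uCoeff_ofCoeff {N : ℕ} (α : Fin N → ℝ) (j : Fin N) : uCoeff j (ofCoeff α) = α j := by
  simp [ofCoeff, uCoeff_u, Fin.val_inj]

lemma natDegree_ofCoeff_lt {N : ℕ} (hN : 0 < N) (α : Fin N → ℝ) : (ofCoeff α).natDegree < N := by
  have h : (ofCoeff α).natDegree ≤ N - 1 := by
    refine natDegree_sum_le_of_forall_le _ _ fun j _ => (natDegree_smul_le _ _).trans ?_
    rw [natDegree_eq_of_degree_eq_some (degree_u j)]
    omega
  omega

lemma absSum_ofCoeff {N : ℕ} (α : Fin N → ℝ) : absSum N (ofCoeff α) = ∑ j, |α j| := by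
  rw [absSum, Finset.sum_range]
  simp only [uCoeff_ofCoeff]

lemma eval_ofCoeff_mul_sin {N : ℕ} (α : Fin N → ℝ) (θ : ℝ) :
    (ofCoeff α).eval (cos θ) * sin θ = ∑ j : Fin N, α j * sin (((j : ℕ) + 1) * θ) := by
  rw [ofCoeff, eval_finsetSum, Finset.sum_mul]
  refine Finset.sum_congr rfl fun j _ => ?_
  have h := Chebyshev.U_real_cos θ (j : ℕ)
  push_cast at h
  rw [eval_smul, smul_eq_mul, mul_assoc, ← h, u]

lemma eval_ofCoeff_nonneg {N : ℕ} {α : Fin N → ℝ} (hα : α ∈ sineSet N) :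
    ∀ x ∈ Set.Icc (-1 : ℝ) 1, 0 ≤ (ofCoeff α).eval x := by
  have hne : (1 - X ^ 2 : ℝ[X]) ≠ 0 := fun hX => by simpa using congrArg (eval 0) hX
  refine eval_nonneg_of_mul hne (fun x hx => ?_) fun x hx => ?_
  · simp only [eval_sub, eval_one, eval_pow, eval_X]
    nlinarith [hx.1, hx.2]
  · have hcos := cos_arccos hx.1 hx.2
    have h1 := hα.2 (arccos x) ⟨arccos_nonneg x, arccos_le_pi x⟩
    rw [← eval_ofCoeff_mul_sin] at h1
    have h2 := mul_nonneg h1 (sin_nonneg_of_nonneg_of_le_pi (arccos_nonneg x) (arccos_le_pi x))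
    have h3 := sin_sq (arccos x)
    rw [hcos] at h2 h3
    simp only [eval_mul, eval_sub, eval_one, eval_pow, eval_X]
    rw [← h3]
    linarith

lemma mem_sineSet_of_eval_nonneg {N : ℕ} {α : Fin N → ℝ} (h1 : ∀ i : Fin N, (i : ℕ) = 0 → α i = 1)
    (h : ∀ x ∈ Set.Icc (-1 : ℝ) 1, 0 ≤ (ofCoeff α).eval x) : α ∈ sineSet N := by
  refine ⟨h1, fun θ hθ => ?_⟩
  rw [← eval_ofCoeff_mul_sin]
  exact mul_nonneg (h _ ⟨neg_one_le_cos θ, cos_le_one θ⟩)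
    (sin_nonneg_of_nonneg_of_le_pi hθ.1 hθ.2)

lemma uCoeff_zero_ofCoeff {N : ℕ} (hN : 0 < N) {α : Fin N → ℝ} (hα : α ∈ sineSet N) :
    uCoeff 0 (ofCoeff α) = 1 :=
  (uCoeff_ofCoeff α ⟨0, hN⟩).trans (hα.1 _ rfl)

lemma isCompact_sineSet {N : ℕ} (hN : 0 < N) : IsCompact (sineSet N) := by
  refine (isCompact_univ_pi fun j : Fin N =>
    isCompact_Icc (a := -((j : ℝ) + 1)) (b := (j : ℝ) + 1)).of_isClosed_subset ?_ fun α hα j _ => ?_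
  · simp only [sineSet, Set.ofPred_and, Set.ofPred_forall]
    refine IsClosed.inter ?_ ?_
    · exact isClosed_iInter fun i => isClosed_iInter fun _ =>
        isClosed_eq (continuous_apply i) continuous_const
    · exact isClosed_iInter fun θ => isClosed_iInter fun _ =>
        isClosed_le continuous_const (by fun_prop)
  · have h := abs_uCoeff_le (eval_ofCoeff_nonneg hα) j
    rw [uCoeff_ofCoeff, uCoeff_zero_ofCoeff hN hα, mul_one] at h
    exact abs_le.1 h

lemma sineSet_nonempty {N : ℕ} (hN : 0 < N) : (sineSet N).Nonempty := by
  have : NeZero N := ⟨hN.ne'⟩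
  refine ⟨fun j => if j = 0 then 1 else 0, fun i hi => if_pos (Fin.ext hi), fun θ hθ => ?_⟩
  simpa using sin_nonneg_of_nonneg_of_le_pi hθ.1 hθ.2

lemma boundsSum_of_forall_mem_sineSet {N : ℕ} {M : ℝ} (h : ∀ α ∈ sineSet N, ∑ j, α j ≤ M) :
    BoundsSum N M := by
  intro P hdeg hP
  rcases (uCoeff_zero_nonneg hP).eq_or_lt with h0 | h0
  · have hn : ∀ n, uCoeff n P = 0 := fun n => by
      have := abs_uCoeff_le hP n
      rw [← h0, mul_zero] at this
      exact abs_nonpos_iff.1 this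
    simp [hn]
  · set α : Fin N → ℝ := fun j => (uCoeff 0 P)⁻¹ * uCoeff j P with hα
    have hPα : ofCoeff α = (uCoeff 0 P)⁻¹ • P := by
      conv_rhs => enter [2]; rw [eq_sum_uCoeff (mem_degreeLT_of_natDegree_lt hdeg)]
      rw [ofCoeff, Finset.smul_sum, Finset.sum_range]
      simp only [hα, mul_smul]
    have hmem : α ∈ sineSet N := by
      refine mem_sineSet_of_eval_nonneg (fun i hi => ?_) fun x hx => ?_
      · simp only [hα, hi]
        exact inv_mul_cancel₀ h0.ne'
      · rw [hPα, eval_smul, smul_eq_mul]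
        exact mul_nonneg (inv_nonneg.2 h0.le) (hP x hx)
    have h1 := h α hmem
    rwa [hα, ← Finset.mul_sum, inv_mul_le_iff₀ h0, mul_comm, ← Finset.sum_range fun n => uCoeff n P]
      at h1

end SinePolynomial

theorem stmt15 (N : ℕ) (hN : 3 ≤ N) :
    ∃ M : ℝ,
      IsGreatest ((fun α : Fin N → ℝ => ∑ j : Fin N, |α j|) '' sineSet N) M
        ∧ IsGreatest ((fun α : Fin N → ℝ => ∑ j : Fin N, α j) '' sineSet N) M
        ∧ ∃ α ∈ sineSet N, (∀ j : Fin N, 0 ≤ α j) ∧ ∑ j : Fin N, |α j| = M := by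
  have hN0 : 0 < N := by omega
  obtain ⟨α, hα, hmax⟩ := (SinePolynomial.isCompact_sineSet hN0).exists_isMaxOn
    (SinePolynomial.sineSet_nonempty hN0)
    (f := fun α : Fin N → ℝ => ∑ j, α j) (by fun_prop)
  have hsum : ∀ β ∈ sineSet N, ∑ j, β j ≤ ∑ j, α j := fun β hβ => hmax hβ
  have habs : ∀ β ∈ sineSet N, ∑ j, |β j| ≤ ∑ j, α j := fun β hβ => by
    have h := (SinePolynomial.boundsSum_of_forall_mem_sineSet hsum).absSum_le hN0
      (SinePolynomial.natDegree_ofCoeff_lt hN0 β) (SinePolynomial.eval_ofCoeff_nonneg hβ)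
    rwa [SinePolynomial.absSum_ofCoeff, SinePolynomial.uCoeff_zero_ofCoeff hN0 hβ, mul_one] at h
  have heq : ∑ j, α j = ∑ j, |α j| :=
    le_antisymm (Finset.sum_le_sum fun j _ => le_abs_self _) (habs α hα)
  have hnonneg : ∀ j, 0 ≤ α j := fun j => by
    rw [(Finset.sum_eq_sum_iff_of_le fun j _ => le_abs_self (α j)).1 heq j (Finset.mem_univ j)]
    exact abs_nonneg _
  refine ⟨∑ j, α j, ⟨⟨α, hα, heq.symm⟩, ?_⟩, ⟨⟨α, hα, rfl⟩, ?_⟩, α, hα, hnonneg, heq.symm⟩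
  · rintro _ ⟨β, hβ, rfl⟩
    exact habs β hβ
  · rintro _ ⟨β, hβ, rfl⟩
    exact hsum β hβ
end
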